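/- arXiv:1312.4515 — 4 statements merged into one kernel-verified Lean document; each statement's English description precedes it below -/
import Mathlib

section
/- For a Karoubi-closed full additive subcategory C of a small abelian category 𝒜, the following conditions are equivalent: (1) every object M of 𝒜 admits a C-cover; (2) every object M of 𝒜 admits a C-resolution; (3) every object X of T_𝒜 = K^-(𝒜) admits a C-approximation. -/
open CategoryTheory Limits

universe v u

variable {A : Type u} [Category.{v} A] [Abelian A]

/-- An object of `K(A)` is bounded above (i.e. lies in `K^-(A)`). -/
def BddAbv (X : HomotopyCategory A (ComplexShape.up ℤ)) : Prop :=
  ∃ N : ℤ, ∀ i > N, IsZero (X.as.X i)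

/-- All terms of the complex lie in the subcategory `𝒞`. -/
def TermsIn (𝒞 : Set A) (X : HomotopyCategory A (ComplexShape.up ℤ)) : Prop :=
  ∀ i : ℤ, X.as.X i ∈ 𝒞

/-- Objects of `T_C = K^-(C)` inside `K(A)`. -/
def InTC (𝒞 : Set A) (X : HomotopyCategory A (ComplexShape.up ℤ)) : Prop :=
  BddAbv X ∧ TermsIn 𝒞 X

/-- Objects of `T≤0_A`. -/
def InTleA (X : HomotopyCategory A (ComplexShape.up ℤ)) : Prop :=
  BddAbv X ∧ ∀ i > 0, IsZero (X.as.X i)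

/-- Objects of `T≤0_C`. -/
def InTleC (𝒞 : Set A) (X : HomotopyCategory A (ComplexShape.up ℤ)) : Prop :=
  InTleA X ∧ TermsIn 𝒞 X

/-- Quasi-isomorphisms in the homotopy category. -/
def IsQIso {X Y : HomotopyCategory A (ComplexShape.up ℤ)} (f : X ⟶ Y) : Prop :=
  ∀ i : ℤ, IsIso ((HomotopyCategory.homologyFunctor A (ComplexShape.up ℤ) i).map f)

/-- `f : Xc ⟶ X` is a `C`-approximation. -/
def IsCApprox (𝒞 : Set A) {Xc X : HomotopyCategory A (ComplexShape.up ℤ)} (f : Xc ⟶ X) : Prop :=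
  InTC 𝒞 Xc ∧ IsQIso f ∧
    ∀ V, InTC 𝒞 V → Function.Bijective (fun g : V ⟶ Xc => g ≫ f)

/-- `C` is `A`-approximating. -/
def CApproximating (𝒞 : Set A) : Prop :=
  ∀ X, BddAbv X → ∃ (Xc : HomotopyCategory A (ComplexShape.up ℤ)) (f : Xc ⟶ X), IsCApprox 𝒞 f

/-- Objects of `T≥0_A = (T≤0_A⟦1⟧)^⊥` in `T_A`. -/
def InTgeA (X : HomotopyCategory A (ComplexShape.up ℤ)) : Prop :=
  BddAbv X ∧ ∀ Y, InTleA Y → ∀ f : Y⟦(1:ℤ)⟧ ⟶ X, f = 0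

/-- Objects of `T≥0_C = (T≤0_C⟦1⟧)^⊥` in `T_C`. -/
def InTgeC (𝒞 : Set A) (X : HomotopyCategory A (ComplexShape.up ℤ)) : Prop :=
  InTC 𝒞 X ∧ ∀ Y, InTleC 𝒞 Y → ∀ f : Y⟦(1:ℤ)⟧ ⟶ X, f = 0

/-- The heart `H_A` of the t-structure on `T_A`. -/
def InHA (X : HomotopyCategory A (ComplexShape.up ℤ)) : Prop :=
  InTleA X ∧ InTgeA X

/-- The heart `H_C` of the t-structure on `T_C`. -/
def InHC (𝒞 : Set A) (X : HomotopyCategory A (ComplexShape.up ℤ)) : Prop :=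
  InTleC 𝒞 X ∧ InTgeC 𝒞 X

/-- `C`-covers. -/
def IsCCover (𝒞 : Set A) {C₀ M : A} (p : C₀ ⟶ M) : Prop :=
  C₀ ∈ 𝒞 ∧ Epi p ∧ ∀ V ∈ 𝒞, ∀ g : V ⟶ M, ∃ h : V ⟶ C₀, h ≫ p = g

/-- A `C`-resolution `⋯ → C¹ → C⁰ → M → 0` of `M`. -/
structure CResolution (𝒞 : Set A) (M : A) where
  obj : ℕ → A
  mem : ∀ n, obj n ∈ 𝒞
  d : ∀ n, obj (n + 1) ⟶ obj n
  ε : obj 0 ⟶ M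
  epi : Epi ε
  w0 : d 0 ≫ ε = 0
  w : ∀ n, d (n + 1) ≫ d n = 0
  exact0 : (ShortComplex.mk (d 0) ε w0).Exact
  exact : ∀ n, (ShortComplex.mk (d (n + 1)) (d n) (w n)).Exact
  homSurj : ∀ V ∈ 𝒞, ∀ g : V ⟶ M, ∃ h : V ⟶ obj 0, h ≫ ε = g
  homExact0 : ∀ V ∈ 𝒞, ∀ g : V ⟶ obj 0, g ≫ ε = 0 → ∃ h : V ⟶ obj 1, h ≫ d 0 = g
  homExact : ∀ n, ∀ V ∈ 𝒞, ∀ g : V ⟶ obj (n + 1),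
    g ≫ d n = 0 → ∃ h : V ⟶ obj (n + 2), h ≫ d (n + 1) = g

/-- `𝒜` has `C`-dimension at most `n`. -/
def CDimLE (𝒞 : Set A) (n : ℕ) : Prop :=
  ∀ M : A, ∃ r : CResolution 𝒞 M, ∀ m > n, IsZero (r.obj m)

/-- `𝒞` is a Karoubi-closed full additive subcategory. -/
structure IsAddKaroubi (𝒞 : Set A) : Prop where
  zero : ∀ Z : A, IsZero Z → Z ∈ 𝒞
  iso : ∀ {X Y : A}, (X ≅ Y) → X ∈ 𝒞 → Y ∈ 𝒞
  biprod : ∀ {X Y : A}, X ∈ 𝒞 → Y ∈ 𝒞 → (X ⊞ Y) ∈ 𝒞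
  summand : ∀ {X Y : A}, X ∈ 𝒞 → ∀ (i : Y ⟶ X) (p : X ⟶ Y), i ≫ p = 𝟙 Y → Y ∈ 𝒞

/-- The object `P_M ∈ H_C` : the complex `M` concentrated in degree `0`. -/
noncomputable def PObj (M : A) : HomotopyCategory A (ComplexShape.up ℤ) :=
  (HomotopyCategory.quotient A (ComplexShape.up ℤ)).obj
    ((HomologicalComplex.single A (ComplexShape.up ℤ) 0).obj M)

/-- The morphism `P_f : P_M ⟶ P_N` induced by `f : M ⟶ N`. -/
noncomputable def PMap {M N : A} (f : M ⟶ N) : PObj M ⟶ PObj N :=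
  (HomotopyCategory.quotient A (ComplexShape.up ℤ)).map
    ((HomologicalComplex.single A (ComplexShape.up ℤ) 0).map f)

section Relative

variable (P : HomotopyCategory A (ComplexShape.up ℤ) → Prop)

/-- Epimorphism relative to the full subcategory `P`. -/
def EpiIn {X Y : HomotopyCategory A (ComplexShape.up ℤ)} (f : X ⟶ Y) : Prop :=
  ∀ Z, P Z → ∀ u v : Y ⟶ Z, f ≫ u = f ≫ v → u = v

/-- Monomorphism relative to the full subcategory `P`. -/
def MonoIn {X Y : HomotopyCategory A (ComplexShape.up ℤ)} (f : X ⟶ Y) : Prop :=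
  ∀ Z, P Z → ∀ u v : Z ⟶ X, u ≫ f = v ≫ f → u = v

/-- Simple object of the full (abelian) subcategory `P`: it is nonzero and every nonzero
morphism into it from an object of `P` is an epimorphism in `P`. -/
def SimpleIn (V : HomotopyCategory A (ComplexShape.up ℤ)) : Prop :=
  P V ∧ ¬ IsZero V ∧ ∀ U, P U → ∀ f : U ⟶ V, f ≠ 0 → EpiIn P f

/-- Projective object of the full subcategory `P`. -/
def ProjectiveIn (Q : HomotopyCategory A (ComplexShape.up ℤ)) : Prop :=
  P Q ∧ ∀ X Y, P X → P Y → ∀ e : X ⟶ Y, EpiIn P e → ∀ g : Q ⟶ Y, ∃ h : Q ⟶ X, h ≫ e = g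

/-- Injective object of the full subcategory `P`. -/
def InjectiveIn (J : HomotopyCategory A (ComplexShape.up ℤ)) : Prop :=
  P J ∧ ∀ X Y, P X → P Y → ∀ m : X ⟶ Y, MonoIn P m → ∀ g : X ⟶ J, ∃ h : Y ⟶ J, m ≫ h = g

/-- `f` is a kernel of `g` relative to the full subcategory `P`. -/
def IsKernelIn {X Y Z : HomotopyCategory A (ComplexShape.up ℤ)} (f : X ⟶ Y) (g : Y ⟶ Z) : Prop :=
  P X ∧ f ≫ g = 0 ∧ ∀ W, P W → ∀ h : W ⟶ Y, h ≫ g = 0 → ∃! l : W ⟶ X, l ≫ f = h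

/-- The sequence `X ⟶ Y ⟶ Z` is exact at `Y` relative to the abelian full subcategory `P`:
the induced map to any kernel of `g` in `P` is an epimorphism in `P`. -/
def ExactIn {X Y Z : HomotopyCategory A (ComplexShape.up ℤ)} (f : X ⟶ Y) (g : Y ⟶ Z) : Prop :=
  f ≫ g = 0 ∧ ∀ (K : HomotopyCategory A (ComplexShape.up ℤ)) (k : K ⟶ Y),
    IsKernelIn P k g → ∀ l : X ⟶ K, l ≫ k = f → EpiIn P l

/-- Short exact sequence `0 ⟶ X ⟶ Y ⟶ Z ⟶ 0` relative to `P`. -/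
def ShortExactIn {X Y Z : HomotopyCategory A (ComplexShape.up ℤ)} (f : X ⟶ Y) (g : Y ⟶ Z) : Prop :=
  MonoIn P f ∧ EpiIn P g ∧ IsKernelIn P f g

end Relative

theorem exists_int_sequence {T : ℤ → Type*} (R : ∀ i, T i → T (i + 1) → Prop) (b : ℤ)
    (t₀ : ∀ i, b ≤ i → T i) (h₀ : ∀ i hi, R i (t₀ i hi) (t₀ (i + 1) (by lia)))
    (step : ∀ i (t' : T (i + 1)), ∃ t : T i, R i t t') :
    ∃ t : ∀ i, T i, (∀ i hi, t i = t₀ i hi) ∧ ∀ i, R i (t i) (t (i + 1)) := by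
  have step' : ∀ k (t' : T k), ∃ t : T (k - 1),
      ∀ s : T (k - 1 + 1), HEq s t' → R (k - 1) t s := by
    intro k t'
    obtain ⟨t, ht⟩ := step (k - 1) (cast (by simp) t')
    refine ⟨t, fun s hs => ?_⟩
    have : s = cast (by simp) t' := eq_of_heq (hs.trans (cast_heq _ _).symm)
    exact this ▸ ht
  choose p hp using step'
  let t : ∀ i, T i := fun i =>
    Int.inductionOn' (motive := T) i b (t₀ b le_rfl)
      (fun k hk _ => t₀ (k + 1) (by lia)) (fun k _ x => p k x)
  have htop : ∀ i hi, t i = t₀ i hi := by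
    intro i hi
    obtain rfl | hlt := eq_or_lt_of_le hi
    · exact Int.inductionOn'_self ..
    · obtain ⟨k, rfl⟩ : ∃ k, i = k + 1 := ⟨i - 1, by simp⟩
      exact Int.inductionOn'_add_one (by lia)
  refine ⟨t, htop, fun i => ?_⟩
  by_cases hi : b ≤ i
  · rw [htop i hi, htop (i + 1) (by lia)]
    exact h₀ i hi
  · obtain ⟨k, rfl⟩ : ∃ k, i = k - 1 := ⟨i + 1, by simp⟩
    have e : t (k - 1) = p k (t k) := Int.inductionOn'_sub_one (by lia)
    rw [e]
    exact hp k (t k) _ (by rw [sub_add_cancel])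

/-- A complex is `𝒞`-acyclic if it becomes exact after applying `Hom(V, -)` for every `V ∈ 𝒞`. -/
def CAcyclic (𝒞 : Set A) (W : CochainComplex A ℤ) : Prop :=
  ∀ V ∈ 𝒞, ∀ i j k : ℤ, i + 1 = j → j + 1 = k → ∀ g : V ⟶ W.X j, g ≫ W.d j k = 0 →
    ∃ h : V ⟶ W.X i, h ≫ W.d i j = g

theorem CAcyclic.homotopy_zero {𝒞 : Set A} {V W : CochainComplex A ℤ} (hW : CAcyclic 𝒞 W)
    (hV : ∀ i, V.X i ∈ 𝒞) {N : ℤ} (hN : ∀ i > N, IsZero (V.X i)) (f : V ⟶ W) :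
    Nonempty (Homotopy f 0) := by
  obtain ⟨t, -, ht⟩ := exists_int_sequence
    (T := fun j => {h : V.X (j + 1) ⟶ W.X j //
      V.d j (j + 1) ≫ (f.f (j + 1) - h ≫ W.d j (j + 1)) = 0})
    (fun j t t' => f.f (j + 1) = t.1 ≫ W.d j (j + 1) + V.d (j + 1) (j + 1 + 1) ≫ t'.1) N
    (fun j hj => ⟨0, by
      rw [(hN (j + 1) (by lia)).eq_of_src (f.f (j + 1)) 0]
      simp⟩)
    (fun j hj => (hN (j + 1) (by lia)).eq_of_src _ _)
    (fun j t' => by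
      obtain ⟨h, hh⟩ := hW _ (hV (j + 1)) j (j + 1) (j + 1 + 1) rfl rfl
        (f.f (j + 1) - V.d (j + 1) (j + 1 + 1) ≫ t'.1) (by
          have := t'.2
          simp only [Preadditive.comp_sub, Preadditive.sub_comp, Category.assoc,
            HomologicalComplex.Hom.comm] at this ⊢
          exact this)
      refine ⟨⟨h, ?_⟩, ?_⟩
      · simp [hh]
      · simp [hh])
  refine ⟨(Homotopy.ofEq ?_).trans
    (Homotopy.nullHomotopy' fun i j hij => (V.XIsoOfEq hij).inv ≫ (t j).1)⟩
  ext i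
  obtain ⟨j, rfl⟩ : ∃ j, i = j + 1 := ⟨i - 1, by simp⟩
  rw [Homotopy.nullHomotopicMap'_f (k₂ := j) (k₀ := j + 1 + 1) rfl rfl]
  refine (ht j).trans ?_
  simp [add_comm]

theorem CAcyclic.eq_zero {𝒞 : Set A} {W : CochainComplex A ℤ} (hW : CAcyclic 𝒞 W)
    {V : HomotopyCategory A (ComplexShape.up ℤ)} (hV : InTC 𝒞 V)
    (g : V ⟶ (HomotopyCategory.quotient A (ComplexShape.up ℤ)).obj W) : g = 0 := by
  obtain ⟨⟨N, hN⟩, hV⟩ := hV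
  obtain ⟨V, rfl⟩ := HomotopyCategory.quotient_obj_surjective V
  obtain ⟨g, rfl⟩ := (HomotopyCategory.quotient A (ComplexShape.up ℤ)).map_surjective g
  obtain ⟨h⟩ := hW.homotopy_zero hV hN g
  exact (HomotopyCategory.eq_of_homotopy _ _ h).trans (Functor.map_zero _ _ _)

theorem CAcyclic.eq_zero_of_shift {𝒞 : Set A} {W : CochainComplex A ℤ} (hW : CAcyclic 𝒞 W)
    {V : HomotopyCategory A (ComplexShape.up ℤ)} (hV : InTC 𝒞 V) (n : ℤ)
    (g : V⟦n⟧ ⟶ (HomotopyCategory.quotient A (ComplexShape.up ℤ)).obj W) : g = 0 := by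
  obtain ⟨⟨N, hN⟩, hV⟩ := hV
  obtain ⟨V, rfl⟩ := HomotopyCategory.quotient_obj_surjective V
  have hV' : InTC 𝒞 ((HomotopyCategory.quotient A (ComplexShape.up ℤ)).obj (V⟦n⟧)) :=
    ⟨⟨N - n, fun i hi => hN (i + n) (by lia)⟩, fun i => hV (i + n)⟩
  rw [← cancel_epi (((HomotopyCategory.quotient A (ComplexShape.up ℤ)).commShiftIso n).app V).hom,
    comp_zero]
  exact hW.eq_zero hV' _

theorem CAcyclic.acyclic {𝒞 : Set A} {W : CochainComplex A ℤ} (hW : CAcyclic 𝒞 W)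
    (hcov : ∀ M : A, ∃ (C₀ : A) (p : C₀ ⟶ M), IsCCover 𝒞 p) : W.Acyclic := by
  intro n
  rw [W.exactAt_iff' (n - 1) n (n + 1) (by simp) (by simp)]
  obtain ⟨C₀, p, hC₀, hp, -⟩ := hcov (kernel (W.d n (n + 1)))
  obtain ⟨h, hh⟩ := hW C₀ hC₀ (n - 1) n (n + 1) (by simp) rfl (p ≫ kernel.ι _) (by simp)
  rw [ShortComplex.exact_iff_exact_up_to_refinements]
  intro Y (y : Y ⟶ W.X n) (hy : y ≫ W.d n (n + 1) = 0)
  refine ⟨pullback p (kernel.lift _ y hy), pullback.snd _ _, inferInstance,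
    pullback.fst _ _ ≫ h, ?_⟩
  change _ = (pullback.fst p (kernel.lift _ y hy) ≫ h) ≫ W.d (n - 1) n
  rw [Category.assoc, hh, pullback.condition_assoc, kernel.lift_ι]
  rfl

theorem isCApprox_of_cacyclic_mappingCone {𝒞 : Set A}
    (hcov : ∀ M : A, ∃ (C₀ : A) (p : C₀ ⟶ M), IsCCover 𝒞 p) {P X : CochainComplex A ℤ}
    (f : P ⟶ X) (hf : CAcyclic 𝒞 (CochainComplex.mappingCone f))
    (hP : InTC 𝒞 ((HomotopyCategory.quotient A (ComplexShape.up ℤ)).obj P)) :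
    IsCApprox 𝒞 ((HomotopyCategory.quotient A (ComplexShape.up ℤ)).map f) := by
  have hT := HomotopyCategory.mappingCone_triangleh_distinguished f
  refine ⟨hP, ?_, fun V hV => ⟨?_, fun g => ?_⟩⟩
  · rw [IsQIso, ← HomotopyCategory.mem_quasiIso_iff,
      HomotopyCategory.quasiIso_eq_trW_subcategoryAcyclic]
    refine (ObjectProperty.trW_iff_of_distinguished _ _ hT).2 ?_
    exact (HomotopyCategory.quotient_obj_mem_subcategoryAcyclic_iff_acyclic _).2 (hf.acyclic hcov)
  · intro a b hab
    rw [← sub_eq_zero]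
    apply (shiftFunctor (HomotopyCategory A (ComplexShape.up ℤ)) (1 : ℤ)).map_injective
    have hab' : (a - b) ≫ (HomotopyCategory.quotient A (ComplexShape.up ℤ)).map f = 0 := by
      rw [Preadditive.sub_comp]
      exact sub_eq_zero.2 hab
    obtain ⟨g, hg⟩ := Pretriangulated.Triangle.coyoneda_exact₁ _ hT ((a - b)⟦(1 : ℤ)⟧')
      ((Functor.map_comp _ _ _).symm.trans ((congrArg _ hab').trans (Functor.map_zero _ _ _)))
    rw [Functor.map_zero]
    refine hg.trans ?_
    rw [hf.eq_zero_of_shift hV 1 g]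
    exact zero_comp
  · obtain ⟨h, hh⟩ := Pretriangulated.Triangle.coyoneda_exact₂ _ hT g (hf.eq_zero hV _)
    exact ⟨h, hh.symm⟩

/-- The terms of degrees `i` and `i + 1` of a complex with a map to `X`, seen from degree `i`. -/
structure ApproxStage (𝒞 : Set A) (X : CochainComplex A ℤ) (i : ℤ) where
  obj : A
  mem : obj ∈ 𝒞
  next : A
  d : obj ⟶ next
  f : obj ⟶ X.X i

/-- Two consecutive stages fit together, the object of the lower one being a cover of the
cocycles of the mapping cone. -/
def ApproxStage.Compatible {𝒞 : Set A} {X : CochainComplex A ℤ} (i : ℤ)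
    (s : ApproxStage 𝒞 X i) (t : ApproxStage 𝒞 X (i + 1)) : Prop :=
  ∃ φ : s.next ≅ t.obj, (s.d ≫ φ.hom) ≫ t.d = 0 ∧
    (s.d ≫ φ.hom) ≫ t.f = s.f ≫ X.d i (i + 1) ∧
    ∀ V ∈ 𝒞, ∀ (p : V ⟶ t.obj) (x : V ⟶ X.X i), p ≫ t.d = 0 → p ≫ t.f = x ≫ X.d i (i + 1) →
      ∃ l : V ⟶ s.obj, l ≫ s.d ≫ φ.hom = p ∧ l ≫ s.f = x

theorem ApproxStage.exists_compatible {𝒞 : Set A} {X : CochainComplex A ℤ}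
    (hcov : ∀ M : A, ∃ (C₀ : A) (p : C₀ ⟶ M), IsCCover 𝒞 p) (i : ℤ)
    (t : ApproxStage 𝒞 X (i + 1)) : ∃ s : ApproxStage 𝒞 X i, s.Compatible i t := by
  obtain ⟨C₀, c, hC₀, -, hlift⟩ := hcov (kernel (biprod.desc
    (biprod.lift t.d t.f) (biprod.lift (0 : X.X i ⟶ t.next) (-X.d i (i + 1)))))
  have h := kernel.condition (biprod.desc
    (biprod.lift t.d t.f) (biprod.lift (0 : X.X i ⟶ t.next) (-X.d i (i + 1))))
  have h₁ := congrArg (· ≫ biprod.fst) h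
  have h₂ := congrArg (· ≫ biprod.snd) h
  simp only [biprod.desc_eq, Category.assoc, Preadditive.add_comp, Preadditive.comp_add,
    biprod.lift_fst, biprod.lift_snd, comp_zero, add_zero, zero_comp, Preadditive.comp_neg,
    add_neg_eq_zero] at h₁ h₂
  refine ⟨⟨C₀, hC₀, t.obj, c ≫ kernel.ι _ ≫ biprod.fst, c ≫ kernel.ι _ ≫ biprod.snd⟩,
    Iso.refl _, by simp [h₁], by simp [h₂], fun V hV p x hp hx => ?_⟩
  obtain ⟨l, hl⟩ := hlift V hV (kernel.lift _ (biprod.lift p x) (by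
    ext <;> simp [hp, hx]))
  refine ⟨l, ?_, ?_⟩
  · simp [reassoc_of% hl]
  · simp [reassoc_of% hl]

open scoped ZeroObject in
theorem exists_cacyclic_mappingCone {𝒞 : Set A} (h𝒞 : IsAddKaroubi 𝒞)
    (hcov : ∀ M : A, ∃ (C₀ : A) (p : C₀ ⟶ M), IsCCover 𝒞 p) (X : CochainComplex A ℤ) (N : ℤ)
    (hN : ∀ i > N, IsZero (X.X i)) :
    ∃ (P : CochainComplex A ℤ) (f : P ⟶ X), (∀ i, P.X i ∈ 𝒞) ∧ (∀ i > N, IsZero (P.X i)) ∧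
      CAcyclic 𝒞 (CochainComplex.mappingCone f) := by
  obtain ⟨t, ht, hR⟩ := exists_int_sequence (ApproxStage.Compatible (𝒞 := 𝒞) (X := X)) (N + 1)
    (fun i _ => ⟨(0 : A), h𝒞.zero _ (isZero_zero A), (0 : A), 0, 0⟩)
    (fun i hi => ⟨Iso.refl _, by simp, by simp, fun V _ p x _ _ =>
      ⟨0, (isZero_zero A).eq_of_tgt _ _, (hN i (by lia)).eq_of_tgt _ _⟩⟩)
    (ApproxStage.exists_compatible hcov)
  choose φ hd hf hl using hR
  let P : CochainComplex A ℤ := CochainComplex.of (fun i => (t i).obj)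
    (fun i => (t i).d ≫ (φ i).hom) (fun i => by rw [← Category.assoc, hd i, zero_comp])
  have hPd : ∀ i, P.d i (i + 1) = (t i).d ≫ (φ i).hom :=
    fun i => by simp [P]
  let f : P ⟶ X :=
    { f := fun i => (t i).f
      comm' := by
        rintro i _ rfl
        rw [hPd]
        exact (hf i).symm }
  refine ⟨P, f, fun i => (t i).mem, fun i hi => ?_, ?_⟩
  · change IsZero (t i).obj
    rw [ht i (by lia)]
    exact isZero_zero A
  · rintro V hV i _ _ rfl rfl g hg
    obtain ⟨h₁, h₂⟩ := (CochainComplex.mappingCone.ext_to_iff f _ _ rfl _ _).1 hg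
    rw [Category.assoc, zero_comp,
      CochainComplex.mappingCone.d_fst_v f (i + 1) (i + 1 + 1) _ rfl rfl, hPd] at h₁
    rw [Category.assoc, zero_comp,
      CochainComplex.mappingCone.d_snd_v f (i + 1) (i + 1 + 1) rfl, Preadditive.comp_add] at h₂
    obtain ⟨l, h₃, h₄⟩ := hl (i + 1) V hV
      (g ≫ (CochainComplex.mappingCone.fst f).1.v (i + 1) (i + 1 + 1) rfl)
      (-(g ≫ (CochainComplex.mappingCone.snd f).v (i + 1) (i + 1) (add_zero _)))
      (by
        rw [← cancel_mono (φ (i + 1 + 1)).hom]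
        simpa using h₁)
      (by
        rw [Preadditive.neg_comp, ← add_eq_zero_iff_eq_neg]
        simpa using h₂)
    refine ⟨-l ≫ (CochainComplex.mappingCone.inl f).v (i + 1) i (by lia), ?_⟩
    apply CochainComplex.mappingCone.ext_to f _ _ rfl
    · rw [Category.assoc, CochainComplex.mappingCone.d_fst_v f i (i + 1) _ rfl rfl, hPd, ← h₃]
      simp
    · rw [Category.assoc, CochainComplex.mappingCone.d_snd_v f i (i + 1) rfl]
      simpa [f, neg_eq_iff_eq_neg] using h₄

theorem cApproximating_of_cover {𝒞 : Set A} (h𝒞 : IsAddKaroubi 𝒞)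
    (hcov : ∀ M : A, ∃ (C₀ : A) (p : C₀ ⟶ M), IsCCover 𝒞 p) : CApproximating 𝒞 := by
  rintro X ⟨N, hN⟩
  obtain ⟨X, rfl⟩ := HomotopyCategory.quotient_obj_surjective X
  obtain ⟨P, f, hP, hPN, hf⟩ := exists_cacyclic_mappingCone h𝒞 hcov X N hN
  exact ⟨_, _, isCApprox_of_cacyclic_mappingCone hcov f hf ⟨⟨N, hPN⟩, hP⟩⟩

theorem exact_of_epi_kernel {X Y Z Z' : A} (f : Y ⟶ Z) (q : X ⟶ kernel f) [Epi q] (g : Y ⟶ Z')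
    (hg : ∀ {T : A} (y : T ⟶ Y), y ≫ g = 0 → y ≫ f = 0) (w : (q ≫ kernel.ι f) ≫ g = 0) :
    (ShortComplex.mk (q ≫ kernel.ι f) g w).Exact := by
  rw [ShortComplex.exact_iff_exact_up_to_refinements]
  intro T (y : T ⟶ Y) (hy : y ≫ g = 0)
  refine ⟨pullback q (kernel.lift f y (hg y hy)), pullback.snd _ _, inferInstance,
    pullback.fst _ _, ?_⟩
  change _ = pullback.fst _ _ ≫ q ≫ kernel.ι f
  rw [pullback.condition_assoc, kernel.lift_ι]

theorem nonempty_cResolution_of_cover {𝒞 : Set A}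
    (hcov : ∀ M : A, ∃ (C₀ : A) (p : C₀ ⟶ M), IsCCover 𝒞 p) (M : A) :
    Nonempty (CResolution 𝒞 M) := by
  choose C p hC hp hlift using hcov
  let K : ℕ → A := fun n => Nat.rec (motive := fun _ => A) M (fun _ Z => kernel (p Z)) n
  have lift_kernel : ∀ (Z : A), ∀ V ∈ 𝒞, ∀ g : V ⟶ C Z, g ≫ p Z = 0 →
      ∃ h : V ⟶ C (kernel (p Z)), h ≫ p (kernel (p Z)) ≫ kernel.ι (p Z) = g := by
    intro Z V hV g hg
    obtain ⟨h, hh⟩ := hlift (kernel (p Z)) V hV (kernel.lift _ g hg)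
    exact ⟨h, by rw [reassoc_of% hh, kernel.lift_ι]⟩
  have cancel : ∀ (Z : A) {T : A} (y : T ⟶ C (kernel (p Z))),
      y ≫ p (kernel (p Z)) ≫ kernel.ι (p Z) = 0 → y ≫ p (kernel (p Z)) = 0 := by
    intro Z T y hy
    rwa [← cancel_mono (kernel.ι (p Z)), Category.assoc, zero_comp]
  exact ⟨{
    obj := fun n => C (K n)
    mem := fun n => hC _
    d := fun n => p (kernel (p (K n))) ≫ kernel.ι (p (K n))
    ε := p M
    epi := hp M
    w0 := by simp [K]
    w := fun n => by simp [K]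
    exact0 := exact_of_epi_kernel (p M) (p (kernel (p M))) _ (fun _ h => h) _
    exact := fun n => exact_of_epi_kernel (p (kernel (p (K n)))) (p (kernel (p (kernel (p (K n))))))
      _ (cancel (K n)) _
    homSurj := hlift M
    homExact0 := lift_kernel M
    homExact := fun n V hV g hg => lift_kernel (kernel (p (K n))) V hV g (cancel (K n) g hg) }⟩

theorem CResolution.isCCover {𝒞 : Set A} {M : A} (r : CResolution 𝒞 M) : IsCCover 𝒞 r.ε :=
  ⟨r.mem 0, r.epi, r.homSurj⟩

theorem IsAddKaroubi.inTC_single {𝒞 : Set A} (h𝒞 : IsAddKaroubi 𝒞) {V : A} (hV : V ∈ 𝒞) (n : ℤ) :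
    InTC 𝒞 ((HomotopyCategory.quotient A (ComplexShape.up ℤ)).obj
      ((HomologicalComplex.single A (ComplexShape.up ℤ) n).obj V)) := by
  refine ⟨⟨n, fun i hi => HomologicalComplex.isZero_single_obj_X _ _ _ _ (by lia)⟩, fun i => ?_⟩
  by_cases hi : i = n
  · exact h𝒞.iso (HomologicalComplex.singleObjXIsoOfEq (ComplexShape.up ℤ) n V i hi).symm hV
  · exact h𝒞.zero _ (HomologicalComplex.isZero_single_obj_X _ _ _ _ hi)

section

variable {𝒞 : Set A} {M : A} {P : CochainComplex A ℤ}
  {f : P ⟶ (HomologicalComplex.single A (ComplexShape.up ℤ) 0).obj M}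

/-- Above degree `0`, a `𝒞`-approximation of an object is exact after applying `Hom(V, -)`
for `V ∈ 𝒞`. -/
theorem IsCApprox.exists_lift (h𝒞 : IsAddKaroubi 𝒞)
    (hf : IsCApprox 𝒞 ((HomotopyCategory.quotient A (ComplexShape.up ℤ)).map f))
    {V : A} (hV : V ∈ 𝒞) {m n : ℤ} (hmn : m + 1 = n) (hn : 0 < n) (g : V ⟶ P.X n)
    (hg : g ≫ P.d n (n + 1) = 0) : ∃ h : V ⟶ P.X m, h ≫ P.d m n = g := by
  let φ : (HomologicalComplex.single A (ComplexShape.up ℤ) n).obj V ⟶ P :=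
    HomologicalComplex.mkHomFromSingle g (by rintro _ rfl; exact hg)
  have hφ : φ ≫ f = 0 := by
    apply HomologicalComplex.from_single_hom_ext
    exact (HomologicalComplex.isZero_single_obj_X _ _ _ _ (by lia)).eq_of_tgt _ _
  have hφ' : (HomotopyCategory.quotient A (ComplexShape.up ℤ)).map φ =
      (HomotopyCategory.quotient A (ComplexShape.up ℤ)).map 0 := by
    apply (hf.2.2 _ (h𝒞.inTC_single hV n)).1
    dsimp only
    rw [← Functor.map_comp, ← Functor.map_comp, hφ, zero_comp]
  have H := (HomotopyCategory.homotopyOfEq _ _ hφ').comm n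
  rw [dNext_eq _ (show (ComplexShape.up ℤ).Rel n (n + 1) from rfl),
    prevD_eq _ (show (ComplexShape.up ℤ).Rel m n from hmn),
    HomologicalComplex.mkHomFromSingle_f, HomologicalComplex.single_obj_d, zero_comp, zero_add,
    HomologicalComplex.zero_f, add_zero] at H
  exact ⟨(HomologicalComplex.singleObjXSelf (ComplexShape.up ℤ) n V).inv ≫
    (HomotopyCategory.homotopyOfEq _ _ hφ').hom n m, by
      rw [Category.assoc, ← H, Iso.inv_hom_id_assoc]⟩

theorem IsCApprox.cycles_mem (h𝒞 : IsAddKaroubi 𝒞)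
    (hf : IsCApprox 𝒞 ((HomotopyCategory.quotient A (ComplexShape.up ℤ)).map f)) {n : ℤ}
    (hn : 0 ≤ n) : P.cycles n ∈ 𝒞 := by
  obtain ⟨⟨⟨N, hN⟩, hP⟩, -⟩ := id hf
  obtain ⟨k, hk⟩ : ∃ k : ℕ, N < n + k := ⟨(N + 1 - n).toNat, by lia⟩
  induction k generalizing n with
  | zero =>
    exact h𝒞.zero _ (IsZero.of_mono (P.iCycles n) (hN n (by lia)))
  | succ k ih =>
    obtain ⟨h, hh⟩ := hf.exists_lift h𝒞 (ih (n := n + 1) (by lia) (by push_cast at hk; lia))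
      rfl (by lia) (P.iCycles (n + 1)) (P.iCycles_d _ _)
    have hd : (𝟙 (P.X n) - P.toCycles n (n + 1) ≫ h) ≫ P.d n (n + 1) = 0 := by
      simp [Preadditive.sub_comp, hh]
    have h₀ : P.iCycles n ≫ P.toCycles n (n + 1) = 0 := by
      simp [← cancel_mono (P.iCycles (n + 1))]
    have hr : P.iCycles n ≫ P.liftCycles (𝟙 (P.X n) - P.toCycles n (n + 1) ≫ h) (n + 1)
        (by simp) hd = 𝟙 _ := by
      rw [← cancel_mono (P.iCycles n), Category.assoc, HomologicalComplex.liftCycles_i,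
        Preadditive.comp_sub, reassoc_of% h₀]
      simp
    exact h𝒞.summand (X := P.X n) (hP n) (P.iCycles n) _ hr

theorem IsCApprox.exists_cover (h𝒞 : IsAddKaroubi 𝒞)
    (hf : IsCApprox 𝒞 ((HomotopyCategory.quotient A (ComplexShape.up ℤ)).map f)) :
    ∃ (C₀ : A) (p : C₀ ⟶ M), IsCCover 𝒞 p := by
  refine ⟨P.cycles 0, P.iCycles 0 ≫ f.f 0 ≫
    (HomologicalComplex.singleObjXSelf (ComplexShape.up ℤ) 0 M).hom,
    hf.cycles_mem h𝒞 le_rfl, ?_, fun V hV g => ?_⟩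
  · have hq : QuasiIso f := (HomotopyCategory.quotient_map_mem_quasiIso_iff f).1
      ((HomotopyCategory.mem_quasiIso_iff _).2 hf.2.1)
    have e : P.iCycles 0 ≫ f.f 0 ≫
        (HomologicalComplex.singleObjXSelf (ComplexShape.up ℤ) 0 M).hom =
        P.homologyπ 0 ≫ HomologicalComplex.homologyMap f 0 ≫
          (HomologicalComplex.singleObjHomologySelfIso (ComplexShape.up ℤ) 0 M).hom := by
      rw [HomologicalComplex.homologyπ_naturality_assoc,
        HomologicalComplex.homologyπ_singleObjHomologySelfIso_hom,
        HomologicalComplex.singleObjCyclesSelfIso_hom,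
        HomologicalComplex.cyclesMap_i_assoc]
    rw [e]
    infer_instance
  · obtain ⟨k, hk⟩ := (hf.2.2 _ (h𝒞.inTC_single hV 0)).2
      ((HomotopyCategory.quotient A (ComplexShape.up ℤ)).map
        ((HomologicalComplex.single A (ComplexShape.up ℤ) 0).map g))
    obtain ⟨k, rfl⟩ := (HomotopyCategory.quotient A (ComplexShape.up ℤ)).map_surjective k
    have H := (HomotopyCategory.homotopyOfEq _ _ ((Functor.map_comp _ _ _).trans hk)).comm 0
    rw [dNext_eq _ (show (ComplexShape.up ℤ).Rel 0 1 from rfl),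
      prevD_eq _ (show (ComplexShape.up ℤ).Rel (-1) 0 from rfl),
      HomologicalComplex.single_obj_d, HomologicalComplex.single_obj_d, zero_comp, comp_zero,
      zero_add, zero_add, HomologicalComplex.single_map_f_self, HomologicalComplex.comp_f] at H
    refine ⟨P.liftCycles ((HomologicalComplex.singleObjXSelf (ComplexShape.up ℤ) 0 V).inv ≫ k.f 0)
      1 (by simp) ?_, ?_⟩
    · rw [Category.assoc, k.comm, HomologicalComplex.single_obj_d, zero_comp, comp_zero]
    · rw [HomologicalComplex.liftCycles_i_assoc, Category.assoc, reassoc_of% H]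
      simp

end

/-!
STATEMENT 1: For a Karoubi-closed full additive subcategory `C` of a small abelian category `A`,
the following are equivalent: (1) every `M ∈ A` admits a `C`-cover; (2) every `M ∈ A` admits a
`C`-resolution; (3) every object of `T_A = K^-(A)` admits a `C`-approximation.
-/
theorem statement1 {A : Type u} [Category.{v} A] [Abelian A]
    (𝒞 : Set A) (h𝒞 : IsAddKaroubi 𝒞) :
    ((∀ M : A, ∃ (C₀ : A) (p : C₀ ⟶ M), IsCCover 𝒞 p) ↔
      (∀ M : A, Nonempty (CResolution 𝒞 M)))
    ∧ ((∀ M : A, Nonempty (CResolution 𝒞 M)) ↔ CApproximating 𝒞) := by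
  have h₁₂ := nonempty_cResolution_of_cover (𝒞 := 𝒞)
  have h₂₁ : (∀ M : A, Nonempty (CResolution 𝒞 M)) →
      ∀ M : A, ∃ (C₀ : A) (p : C₀ ⟶ M), IsCCover 𝒞 p :=
    fun h M => ⟨_, _, (h M).some.isCCover⟩
  refine ⟨⟨h₁₂, h₂₁⟩, fun h => cApproximating_of_cover h𝒞 (h₂₁ h), fun h => h₁₂ fun M => ?_⟩
  obtain ⟨P, f, hf⟩ := h (PObj M) ⟨0, fun i hi =>
    HomologicalComplex.isZero_single_obj_X _ _ _ _ (by lia)⟩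
  obtain ⟨P, rfl⟩ := HomotopyCategory.quotient_obj_surjective P
  obtain ⟨f, rfl⟩ := (HomotopyCategory.quotient A (ComplexShape.up ℤ)).map_surjective f
  exact hf.exists_cover h𝒞
end

section
/- Assume C is 𝒜-approximating. Then T≤0_C = {X ∈ T_C : X^i = 0 for all i > 0} is a t-structure on T_C, i.e. the inclusion T≤0_C → T_C admits a right adjoint; moreover this right adjoint is given by π_C ∘ τ≤0_𝒜 restricted to T_C, where τ≤0_𝒜(X) = [⋯ → X^{-2} → X^{-1} → Ker(X^0 → X^1) → 0] is the smart truncation in T_𝒜. -/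
open CategoryTheory Limits

universe v u

variable {A : Type u} [Category.{v} A] [Abelian A]

namespace CochainComplex

lemma isIso_ιTruncLE_f (K : CochainComplex A ℤ) (n i : ℤ) (hi : i < n) :
    IsIso ((K.ιTruncLE n).f i) := by
  obtain ⟨k, hk⟩ := Int.le.dest hi.le
  have hk' : (ComplexShape.embeddingUpIntLE n).op.f k = i := by
    change n - (k : ℤ) = i
    lia
  have hb : ¬ (ComplexShape.embeddingUpIntLE n).op.BoundaryGE k := by
    rw [ComplexShape.Embedding.op_boundaryGE_iff, ComplexShape.boundaryLE_embeddingUpIntLE_iff]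
    lia
  have h : IsIso ((HomologicalComplex.πTruncGE (HomologicalComplex.op K)
      (ComplexShape.embeddingUpIntLE n).op).f i) :=
    (ComplexShape.Embedding.isIso_liftExtend_f_iff _ _ _ hk').2
      (HomologicalComplex.isIso_restrictionToTruncGE' _ _ _ hb)
  exact inferInstanceAs (IsIso ((HomologicalComplex.πTruncGE (HomologicalComplex.op K)
      (ComplexShape.embeddingUpIntLE n).op).f i).unop)

instance mono_ιTruncLE (K : CochainComplex A ℤ) (n : ℤ) : Mono (K.ιTruncLE n) :=
  inferInstanceAs (Mono (HomologicalComplex.ιTruncLE K _))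

instance mono_ιTruncLE_f (K : CochainComplex A ℤ) (n i : ℤ) : Mono ((K.ιTruncLE n).f i) :=
  inferInstanceAs (Mono ((HomologicalComplex.ιTruncLE K _).f i))

lemma exists_lift_truncLE {W K : CochainComplex A ℤ} (n : ℤ) [W.IsStrictlyLE n] (f : W ⟶ K) :
    ∃ g : W ⟶ K.truncLE n, g ≫ K.ιTruncLE n = f :=
  ⟨inv (W.ιTruncLE n) ≫ truncLEMap f n, by simp⟩

lemma exists_lift_truncLE_of_f_eq_zero {W K : CochainComplex A ℤ} (n : ℤ) (f : W ⟶ K)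
    (hf : ∀ i, n < i → f.f i = 0) :
    ∃ g : W ⟶ K.truncLE n, g ≫ K.ιTruncLE n = f := by
  have : CochainComplex.IsStrictlyLE (Abelian.image f) n := by
    rw [isStrictlyLE_iff]
    intro i hi
    have hfac : (Abelian.factorThruImage f).f i ≫ (Abelian.image.ι f).f i = 0 := by
      rw [← HomologicalComplex.comp_f, Abelian.image.fac, hf i hi]
    have hι : (Abelian.image.ι f).f i = 0 := by
      rwa [← cancel_epi ((Abelian.factorThruImage f).f i), comp_zero]
    rw [IsZero.iff_id_eq_zero, ← cancel_mono ((Abelian.image.ι f).f i), hι, comp_zero, comp_zero]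
  obtain ⟨g, hg⟩ := exists_lift_truncLE n (Abelian.image.ι f)
  exact ⟨Abelian.factorThruImage f ≫ g, by rw [Category.assoc, hg, Abelian.image.fac]⟩

/-- A null-homotopy of `g ≫ K.ιTruncLE n` lifts to `K.truncLE n` when the source of `g`
is strictly `≤ n`. -/
lemma nonempty_homotopy_zero_of_comp_ιTruncLE {W K : CochainComplex A ℤ} (n : ℤ)
    [W.IsStrictlyLE n] (g : W ⟶ K.truncLE n) (h : Homotopy (g ≫ K.ιTruncLE n) 0) :
    Nonempty (Homotopy g 0) := by
  have key : ∀ i j, ∃ l : W.X i ⟶ (K.truncLE n).X j, l ≫ (K.ιTruncLE n).f j = h.hom i j := by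
    intro i j
    by_cases hij : j + 1 = i
    · by_cases hi : n < i
      · exact ⟨0, (W.isZero_of_isStrictlyLE n i hi).eq_of_src _ _⟩
      · have := K.isIso_ιTruncLE_f n j (by lia)
        exact ⟨h.hom i j ≫ inv ((K.ιTruncLE n).f j), by simp⟩
    · exact ⟨0, by rw [zero_comp, h.zero i j hij]⟩
  choose l hl using key
  refine ⟨⟨l, fun i j hij => ?_, fun i => ?_⟩⟩
  · rw [← cancel_mono ((K.ιTruncLE n).f j), hl, h.zero i j hij, zero_comp]
  · have hc := h.comm i
    rw [dNext_eq _ (show (ComplexShape.up ℤ).Rel i (i + 1) by simp),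
      prevD_eq _ (show (ComplexShape.up ℤ).Rel (i - 1) i by simp)] at hc ⊢
    rw [← cancel_mono ((K.ιTruncLE n).f i)]
    simpa only [HomologicalComplex.comp_f, HomologicalComplex.zero_f, add_zero, zero_add,
      Preadditive.add_comp, Category.assoc, hl, ← (K.ιTruncLE n).comm, reassoc_of% hl] using hc

/-- If the top differential of a complex strictly `≤ n + 1` is a split epimorphism, then its
truncation `≤ n` is a strong deformation retract of it. -/
lemma exists_retraction_ιTruncLE (Y : CochainComplex A ℤ) (n : ℤ) [Y.IsStrictlyLE (n + 1)]
    (s : Y.X (n + 1) ⟶ Y.X n) (hs : s ≫ Y.d n (n + 1) = 𝟙 _) :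
    ∃ r : Y ⟶ Y.truncLE n, Y.ιTruncLE n ≫ r = 𝟙 _ ∧
      Nonempty (Homotopy (r ≫ Y.ιTruncLE n) (𝟙 Y)) := by
  obtain ⟨h, h_ne, h_zero, h_top⟩ : ∃ h : ∀ i j, Y.X i ⟶ Y.X j,
      (∀ i j, i ≠ n + 1 → h i j = 0) ∧
      (∀ i j, ¬ (ComplexShape.up ℤ).Rel j i → h i j = 0) ∧ h (n + 1) n = s :=
    ⟨fun i j => if hij : i = n + 1 ∧ j = n then
        (Y.XIsoOfEq hij.1).hom ≫ s ≫ (Y.XIsoOfEq hij.2).inv else 0,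
      fun i j hi => dif_neg fun H => hi H.1,
      fun i j hij => dif_neg fun H => hij (by simp [H.1, H.2]), by simp⟩
  have hf : ∀ i, (Homotopy.nullHomotopicMap h).f i =
      Y.d i (i + 1) ≫ h (i + 1) i + h i (i - 1) ≫ Y.d (i - 1) i := fun i =>
    Homotopy.nullHomotopicMap_f (by simp) (by simp) h
  obtain ⟨r, hr⟩ := exists_lift_truncLE_of_f_eq_zero n (𝟙 Y - Homotopy.nullHomotopicMap h) (by
    intro i hi
    by_cases hi' : i = n + 1
    · subst hi'
      have : (Homotopy.nullHomotopicMap h).f (n + 1) = 𝟙 _ := by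
        rw [Homotopy.nullHomotopicMap_f (k₂ := n) (k₀ := n + 1 + 1) (by simp) (by simp),
          h_ne (n + 1 + 1) _ (by lia), h_top, hs, comp_zero, zero_add]
      simp [this]
    · exact (Y.isZero_of_isStrictlyLE (n + 1) i (by lia)).eq_of_src _ _)
  refine ⟨r, ?_, ⟨?_⟩⟩
  · rw [← cancel_mono (Y.ιTruncLE n), Category.assoc, hr, Category.id_comp, Preadditive.comp_sub,
      Category.comp_id, sub_eq_self]
    ext i
    rw [HomologicalComplex.comp_f, hf, HomologicalComplex.zero_f, Preadditive.comp_add]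
    by_cases hi : i = n
    · subst hi
      rw [h_ne i _ (by lia), HomologicalComplex.Hom.comm_assoc,
        ((Y.truncLE i).isZero_of_isStrictlyLE i (i + 1)).eq_of_src ((Y.ιTruncLE i).f (i + 1)) 0]
      simp
    · rw [h_ne (i + 1) _ (by lia)]
      by_cases hi' : i = n + 1
      · exact ((Y.truncLE n).isZero_of_isStrictlyLE n i (by lia)).eq_of_src _ _
      · rw [h_ne i _ hi']
        simp
  · rw [hr]
    exact (Homotopy.equivSubZero.symm
      ((Homotopy.ofEq (sub_sub_cancel _ _)).trans (Homotopy.nullHomotopy h h_zero))).symm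

end CochainComplex

namespace HomotopyCategory

open CochainComplex

lemma exists_cochainComplex (X : HomotopyCategory A (ComplexShape.up ℤ)) :
    ∃ K : CochainComplex A ℤ, (quotient A (ComplexShape.up ℤ)).obj K = X :=
  X.quotient_obj_surjective

lemma isIso_homologyFunctor_map_ιTruncLE (K : CochainComplex A ℤ) (n i : ℤ) (hi : i ≤ n) :
    IsIso ((homologyFunctor A (ComplexShape.up ℤ) i).map
      ((quotient A (ComplexShape.up ℤ)).map (K.ιTruncLE n))) := by
  have h := K.quasiIsoAt_ιTruncLE n i hi
  rw [quasiIsoAt_iff_isIso_homologyMap] at h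
  exact (NatIso.isIso_map_iff (homologyFunctorFactors A (ComplexShape.up ℤ) i) _).2 h

lemma bijective_comp_ιTruncLE (K : CochainComplex A ℤ) (n : ℤ)
    (W : HomotopyCategory A (ComplexShape.up ℤ)) [CochainComplex.IsStrictlyLE W.as n] :
    Function.Bijective (fun g : W ⟶ (quotient A (ComplexShape.up ℤ)).obj (K.truncLE n) =>
      g ≫ (quotient A (ComplexShape.up ℤ)).map (K.ιTruncLE n)) := by
  obtain ⟨W, rfl⟩ := W.exists_cochainComplex
  have : W.IsStrictlyLE n := ‹_›
  constructor
  · intro g₁ g₂ hg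
    dsimp only at hg
    rw [← sub_eq_zero] at hg ⊢
    rw [← Preadditive.sub_comp] at hg
    obtain ⟨g, hg'⟩ := (quotient A (ComplexShape.up ℤ)).map_surjective (g₁ - g₂)
    rw [← hg', ← Functor.map_comp, quotient_map_eq_zero_iff] at hg
    rw [← hg', quotient_map_eq_zero_iff]
    exact nonempty_homotopy_zero_of_comp_ιTruncLE n g hg.some
  · intro f
    obtain ⟨f, rfl⟩ := (quotient A (ComplexShape.up ℤ)).map_surjective f
    obtain ⟨g, rfl⟩ := exists_lift_truncLE n f
    exact ⟨(quotient A (ComplexShape.up ℤ)).map g, (Functor.map_comp _ _ _).symm⟩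

end HomotopyCategory

open HomotopyCategory

lemma IsCApprox.iso_comp {𝒞 : Set A} {Y' Y X : HomotopyCategory A (ComplexShape.up ℤ)} {a : Y ⟶ X}
    (ha : IsCApprox 𝒞 a) (e : Y' ⟶ Y) [IsIso e] (hY' : InTC 𝒞 Y') : IsCApprox 𝒞 (e ≫ a) := by
  refine ⟨hY', fun i => ?_, fun V hV => ?_⟩
  · have := ha.2.1 i
    rw [Functor.map_comp]
    infer_instance
  · have he : Function.Bijective (fun g : V ⟶ Y' => g ≫ e) :=
      ⟨fun g₁ g₂ h => (cancel_mono e).1 h, fun g => ⟨g ≫ inv e, by simp⟩⟩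
    simpa only [Function.comp_def, Category.assoc] using (ha.2.2 V hV).comp he

/-- If `X` vanishes in degree `n`, the top differential of a `C`-approximation of `X`
which is strictly `≤ n` admits a section. -/
lemma IsCApprox.exists_section_d {𝒞 : Set A} (h𝒞 : IsAddKaroubi 𝒞) {Y K : CochainComplex A ℤ}
    {a : (quotient A (ComplexShape.up ℤ)).obj Y ⟶ (quotient A (ComplexShape.up ℤ)).obj K}
    (ha : IsCApprox 𝒞 a) (n : ℤ) [Y.IsStrictlyLE (n + 1)] (hK : IsZero (K.X (n + 1))) :
    ∃ s : Y.X (n + 1) ⟶ Y.X n, s ≫ Y.d n (n + 1) = 𝟙 _ := by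
  let V : CochainComplex A ℤ := (HomologicalComplex.single A (ComplexShape.up ℤ) (n + 1)).obj (Y.X (n + 1))
  let j : V ⟶ Y := HomologicalComplex.mkHomFromSingle (𝟙 _) fun k hk =>
    (Y.isZero_of_isStrictlyLE (n + 1) k (by simp at hk; lia)).eq_of_tgt _ _
  have hV : InTC 𝒞 ((quotient A (ComplexShape.up ℤ)).obj V) := by
    refine ⟨⟨n + 1, fun i hi => HomologicalComplex.isZero_single_obj_X _ _ _ _ (by lia)⟩, fun i => ?_⟩
    by_cases hi : i = n + 1
    · subst hi
      exact h𝒞.iso (HomologicalComplex.singleObjXSelf _ _ _).symm (ha.1.2 _)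
    · exact h𝒞.zero _ (HomologicalComplex.isZero_single_obj_X _ _ _ _ hi)
  have hzero : ∀ f : (quotient A (ComplexShape.up ℤ)).obj V ⟶
      (quotient A (ComplexShape.up ℤ)).obj K, f = 0 := by
    intro f
    obtain ⟨f, rfl⟩ := (quotient A (ComplexShape.up ℤ)).map_surjective f
    have : f = 0 := HomologicalComplex.from_single_hom_ext (hK.eq_of_tgt _ _)
    rw [this, Functor.map_zero]
  have hj : (quotient A (ComplexShape.up ℤ)).map j = 0 :=
    (ha.2.2 _ hV).1 ((hzero _).trans (hzero _).symm)
  obtain ⟨h⟩ := (quotient_map_eq_zero_iff j).1 hj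
  have hc := h.comm (n + 1)
  rw [prevD_eq _ (show (ComplexShape.up ℤ).Rel n (n + 1) by simp),
    dNext_eq _ (show (ComplexShape.up ℤ).Rel (n + 1) (n + 1 + 1) by simp)] at hc
  refine ⟨(HomologicalComplex.singleObjXSelf _ _ _).inv ≫ h.hom (n + 1) n, ?_⟩
  simp only [j, V, HomologicalComplex.mkHomFromSingle_f, HomologicalComplex.single_obj_d,
    zero_comp, zero_add, HomologicalComplex.zero_f, add_zero, Category.comp_id] at hc
  rw [Category.assoc, ← hc, Iso.inv_hom_id]

/-- A `C`-approximation which is strictly `≤ n + 1` of an object vanishing in degree `n + 1`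
can be replaced by one which is strictly `≤ n`. -/
lemma IsCApprox.exists_truncLE {𝒞 : Set A} (h𝒞 : IsAddKaroubi 𝒞) {Y K : CochainComplex A ℤ}
    {a : (quotient A (ComplexShape.up ℤ)).obj Y ⟶ (quotient A (ComplexShape.up ℤ)).obj K}
    (ha : IsCApprox 𝒞 a) (n : ℤ) [Y.IsStrictlyLE (n + 1)] (hK : IsZero (K.X (n + 1))) :
    ∃ a' : (quotient A (ComplexShape.up ℤ)).obj (Y.truncLE n) ⟶
      (quotient A (ComplexShape.up ℤ)).obj K, IsCApprox 𝒞 a' := by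
  obtain ⟨s, hs⟩ := ha.exists_section_d h𝒞 n hK
  obtain ⟨r, hr, ⟨h⟩⟩ := Y.exists_retraction_ιTruncLE n s hs
  let e : HomotopyEquiv (Y.truncLE n) Y := ⟨Y.ιTruncLE n, r, Homotopy.ofEq hr, h⟩
  refine ⟨_, ha.iso_comp (isoOfHomotopyEquiv e).hom
    ⟨⟨n, fun i hi => (Y.truncLE n).isZero_of_isStrictlyLE n i⟩, fun i => ?_⟩⟩
  exact h𝒞.summand (ha.1.2 i) ((Y.ιTruncLE n).f i) (r.f i)
    (HomologicalComplex.congr_hom hr i)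

/-- A strictly `≤ m` complex admitting a `C`-approximation admits a strictly `≤ m` one. -/
lemma IsCApprox.exists_isStrictlyLE {𝒞 : Set A} (h𝒞 : IsAddKaroubi 𝒞) {K : CochainComplex A ℤ}
    (m : ℤ) [K.IsStrictlyLE m] (n : ℕ) {Y : CochainComplex A ℤ} [Y.IsStrictlyLE (m + n)]
    {a : (quotient A (ComplexShape.up ℤ)).obj Y ⟶ (quotient A (ComplexShape.up ℤ)).obj K}
    (ha : IsCApprox 𝒞 a) :
    ∃ (Y' : CochainComplex A ℤ) (a' : (quotient A (ComplexShape.up ℤ)).obj Y' ⟶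
      (quotient A (ComplexShape.up ℤ)).obj K), Y'.IsStrictlyLE m ∧ IsCApprox 𝒞 a' := by
  induction n generalizing Y with
  | zero =>
    have : Y.IsStrictlyLE m := Y.isStrictlyLE_of_le (m + (0 : ℕ)) m (by simp)
    exact ⟨Y, a, this, ha⟩
  | succ n ih =>
    have : Y.IsStrictlyLE (m + n + 1) :=
      Y.isStrictlyLE_of_le (m + (n + 1 : ℕ)) _ (by lia)
    obtain ⟨a', ha'⟩ := ha.exists_truncLE h𝒞 (m + n) (K.isZero_of_isStrictlyLE m _)
    exact ih ha'

/-!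
STATEMENT 2: Assume `C` is `A`-approximating.  Then `T≤0_C = {X ∈ T_C : Xⁱ = 0 for i > 0}`
is a t-structure on `T_C`, i.e. the inclusion `T≤0_C → T_C` admits a right adjoint; moreover
the right adjoint is `π_C ∘ τ≤0_A`.  We express this pointwise: for every `X ∈ T_C` there is
a smart truncation `tA = τ≤0_A X` (with its universal property in `T_A`), a `C`-approximation
`tC = π_C tA`, and the composite `tC ⟶ tA ⟶ X` is universal from `T≤0_C`, which is exactly
the statement that `X ↦ π_C (τ≤0_A X)` is right adjoint to the inclusion `T≤0_C → T_C`.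
-/
theorem statement2 {A : Type u} [Category.{v} A] [Abelian A]
    (𝒞 : Set A) (h𝒞 : IsAddKaroubi 𝒞) (happrox : CApproximating 𝒞) :
    ∀ X, InTC 𝒞 X →
      ∃ (tA : HomotopyCategory A (ComplexShape.up ℤ)) (q : tA ⟶ X),
        -- `tA` is the smart truncation `τ≤0_A X`:
        InTleA tA ∧
        (∀ i : ℤ, i ≤ 0 →
          IsIso ((HomotopyCategory.homologyFunctor A (ComplexShape.up ℤ) i).map q)) ∧
        (∀ W, InTleA W → Function.Bijective (fun g : W ⟶ tA => g ≫ q)) ∧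
        -- and a `C`-approximation `tC = π_C tA` of it:
        ∃ (tC : HomotopyCategory A (ComplexShape.up ℤ)) (a : tC ⟶ tA),
          IsCApprox 𝒞 a ∧ InTleC 𝒞 tC ∧
          -- the composite `tC ⟶ X` is universal from `T≤0_C`; this says exactly that the
          -- inclusion `T≤0_C → T_C` has right adjoint `π_C ∘ τ≤0_A`:
          (∀ W, InTleC 𝒞 W → Function.Bijective (fun g : W ⟶ tC => g ≫ (a ≫ q))) := by
  intro X hX
  obtain ⟨K, rfl⟩ := X.exists_cochainComplex
  let T := K.truncLE 0
  have hT : InTleA ((quotient A (ComplexShape.up ℤ)).obj T) :=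
    ⟨⟨0, fun i hi => T.isZero_of_isStrictlyLE 0 i⟩, fun i hi => T.isZero_of_isStrictlyLE 0 i⟩
  have huniv : ∀ W, InTleA W →
      Function.Bijective (fun g : W ⟶ (quotient A (ComplexShape.up ℤ)).obj T =>
        g ≫ (quotient A (ComplexShape.up ℤ)).map (K.ιTruncLE 0)) := by
    intro W hW
    have : CochainComplex.IsStrictlyLE W.as 0 := (CochainComplex.isStrictlyLE_iff _ _).2 hW.2
    exact bijective_comp_ιTruncLE K 0 W
  refine ⟨(quotient A (ComplexShape.up ℤ)).obj T,
    (quotient A (ComplexShape.up ℤ)).map (K.ιTruncLE 0), hT,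
    isIso_homologyFunctor_map_ιTruncLE K 0, huniv, ?_⟩
  obtain ⟨Y, a, ha⟩ := happrox _ hT.1
  obtain ⟨Y, rfl⟩ := Y.exists_cochainComplex
  obtain ⟨N, hN⟩ := ha.1.1
  have : Y.IsStrictlyLE (0 + N.toNat) := by
    rw [CochainComplex.isStrictlyLE_iff]
    exact fun i hi => hN i (by lia)
  obtain ⟨Y', a', hY', ha'⟩ := ha.exists_isStrictlyLE h𝒞 0 N.toNat
  refine ⟨_, a', ha', ⟨⟨ha'.1.1, fun i hi => Y'.isZero_of_isStrictlyLE 0 i⟩, ha'.1.2⟩, ?_⟩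
  intro W hW
  simpa only [Function.comp_def, Category.assoc] using
    (huniv W hW.1).comp (ha'.2.2 W ⟨hW.1.1, hW.2⟩)
end

section
/- Assume C is 𝒜-approximating and 𝒜 has finite C-dimension. Then T^b_C ∩ T≤0_C is a t-structure on the bounded homotopy category T^b_C = K^b(C), and its heart is equivalent (via the inclusion T^b_C → T_C) to the heart H_C of the t-structure T≤0_C on T_C. -/
open CategoryTheory Limits

universe v u

variable {A : Type u} [Category.{v} A] [Abelian A]

/-- Bounded complexes (objects of `K^b`). -/
def Bdd {A : Type u} [Category.{v} A] [Abelian A]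
    (X : HomotopyCategory A (ComplexShape.up ℤ)) : Prop :=
  ∃ a b : ℤ, ∀ i : ℤ, (i < a ∨ b < i) → IsZero (X.as.X i)

/-- Objects of `T^b_C = K^b(C)`. -/
def InTCb {A : Type u} [Category.{v} A] [Abelian A] (𝒞 : Set A)
    (X : HomotopyCategory A (ComplexShape.up ℤ)) : Prop :=
  Bdd X ∧ TermsIn 𝒞 X

/-- Objects of `T^b_C ∩ T≤0_C`. -/
def InTleCb {A : Type u} [Category.{v} A] [Abelian A] (𝒞 : Set A)
    (X : HomotopyCategory A (ComplexShape.up ℤ)) : Prop :=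
  InTCb 𝒞 X ∧ ∀ i > 0, IsZero (X.as.X i)

/-- The heart of the t-structure `T^b_C ∩ T≤0_C` on `T^b_C`. -/
def InHCb {A : Type u} [Category.{v} A] [Abelian A] (𝒞 : Set A)
    (X : HomotopyCategory A (ComplexShape.up ℤ)) : Prop :=
  InTleCb 𝒞 X ∧ ∀ Y, InTleCb 𝒞 Y → ∀ f : Y⟦(1:ℤ)⟧ ⟶ X, f = 0

section BoundedTruncation

open Pretriangulated HomologicalComplex
open scoped ZeroObject

namespace CochainComplex

open HomComplex

/-- The recursion step for constructing a null-homotopy in descending degrees. -/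
lemma exists_extend_nullHomotopy {W X : CochainComplex A ℤ} (f : W ⟶ X) (m : ℤ)
    (hX : ∀ g : W.X m ⟶ X.X m, g ≫ X.d m (m + 1) = 0 → ∃ h, h ≫ X.d (m - 1) m = g)
    (α : Cochain W X (-1))
    (hα : ∀ p > m, (δ (-1) 0 α).v p p (add_zero p) = f.f p) :
    ∃ β : Cochain W X (-1), (∀ p ≥ m, (δ (-1) 0 β).v p p (add_zero p) = f.f p) ∧
      ∀ (p q : ℤ) (hpq : p + -1 = q), m < p → β.v p q hpq = α.v p q hpq := by
  obtain ⟨h, hh⟩ := hX (f.f m - W.d m (m + 1) ≫ α.v (m + 1) m (by omega)) (by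
    have h₁ := hα (m + 1) (by omega)
    rw [δ_v (-1) 0 (neg_add_cancel 1) α (m + 1) (m + 1) (by omega) m (m + 2)
      (by omega) (by omega)] at h₁
    simp [Preadditive.sub_comp, ← h₁])
  have key : ∀ (p q : ℤ) (hpq : p + -1 = q), m < p →
      (α + Cochain.single (h - α.v m (m - 1) (by omega)) (-1)).v p q hpq = α.v p q hpq := by
    intro p q hpq hp
    rw [Cochain.add_v, Cochain.single_v_eq_zero _ _ _ _ _ (by omega), add_zero]
  refine ⟨α + Cochain.single (h - α.v m (m - 1) (by omega)) (-1), ?_, key⟩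
  intro p hp
  obtain hp | rfl := hp.lt_or_eq
  · rw [← hα p hp, δ_v (-1) 0 (neg_add_cancel 1) _ p p _ (p - 1) (p + 1) rfl rfl,
      δ_v (-1) 0 (neg_add_cancel 1) _ p p _ (p - 1) (p + 1) rfl rfl, key _ _ _ hp,
      key _ _ _ (by omega)]
  · rw [δ_v (-1) 0 (neg_add_cancel 1) _ m m _ (m - 1) (m + 1) rfl rfl,
      key (m + 1) m _ (by omega), Cochain.add_v, Cochain.single_v]
    simp [hh]

/-- A morphism from a bounded above complex `W` to a complex which is acyclic, in the relevant
degrees, with respect to the terms of `W`, is null-homotopic. -/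
lemma nonempty_homotopy_zero {W X : CochainComplex A ℤ} (f : W ⟶ X) (N : ℤ)
    (hW : ∀ i > N, IsZero (W.X i))
    (hX : ∀ i ≤ N, ∀ g : W.X i ⟶ X.X i, g ≫ X.d i (i + 1) = 0 →
      ∃ h, h ≫ X.d (i - 1) i = g) :
    Nonempty (Homotopy f 0) := by
  have hN : ∀ (p : ℤ) (n : ℕ), N - ((n + 1 : ℕ) : ℤ) < p → N - n ≤ p := by
    intro p n hp; omega
  have hN' : ∀ (p : ℤ) (n k : ℕ), N - n < p → N - ((n + k : ℕ) : ℤ) < p := by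
    intro p n k hp; omega
  let S (n : ℕ) := { α : Cochain W X (-1) //
    ∀ p > N - n, (δ (-1) 0 α).v p p (add_zero p) = f.f p }
  have step : ∀ (n : ℕ) (α : S n), ∃ β : S (n + 1),
      ∀ (p q : ℤ) (hpq : p + -1 = q), N - n < p → β.1.v p q hpq = α.1.v p q hpq := by
    rintro n ⟨α, hα⟩
    obtain ⟨β, hβ, hβ'⟩ := exists_extend_nullHomotopy f (N - n) (hX _ (by omega)) α hα
    exact ⟨⟨β, fun p hp => hβ p (hN p n hp)⟩, hβ'⟩
  choose φ hφ using step
  obtain ⟨s, hs'⟩ : ∃ s : ∀ n, S n, ∀ n, s (n + 1) = φ n (s n) :=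
    ⟨Nat.rec ⟨0, fun p hp => (hW p (by simpa using hp)).eq_of_src _ _⟩ φ, fun _ => rfl⟩
  have hs : ∀ (n k : ℕ) (p q : ℤ) (hpq : p + -1 = q), N - n < p →
      (s (n + k)).1.v p q hpq = (s n).1.v p q hpq := by
    intro n k p q hpq hp
    induction k with
    | zero => rfl
    | succ k ih => rw [← ih, ← add_assoc, hs']; exact hφ (n + k) (s (n + k)) p q hpq (hN' p n k hp)
  let γ : Cochain W X (-1) :=
    Cochain.mk fun p q hpq => (s (N + 1 - p).toNat).1.v p q hpq
  have hγ : ∀ (n : ℕ) (p q : ℤ) (hpq : p + -1 = q), N - n < p →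
      γ.v p q hpq = (s n).1.v p q hpq := by
    intro n p q hpq hp
    obtain ⟨k, hk⟩ : ∃ k, n = (N + 1 - p).toNat + k := ⟨n - (N + 1 - p).toNat, by omega⟩
    rw [hk, hs _ _ _ _ _ (by omega)]
    rfl
  refine ⟨(Cochain.equivHomotopy f 0).symm ⟨γ, ?_⟩⟩
  rw [Cochain.ofHom_zero, add_zero]
  ext p
  have h₁ := (s (N + 1 - p).toNat).2 p (by omega)
  rw [Cochain.ofHom_v, ← h₁, δ_v (-1) 0 (neg_add_cancel 1) _ p p _ (p - 1) (p + 1) rfl rfl,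
    δ_v (-1) 0 (neg_add_cancel 1) _ p p _ (p - 1) (p + 1) rfl rfl,
    hγ (N + 1 - p).toNat _ _ _ (by omega), hγ (N + 1 - p).toNat _ _ _ (by omega)]

/-- The brutal truncations of a cochain complex form a degreewise split short exact sequence. -/
lemma exists_brutal_truncation (X : CochainComplex A ℤ) (k : ℤ) :
    ∃ (S : ShortComplex (CochainComplex A ℤ)) (_ : S.X₂ = X)
      (_ : ∀ n, (S.map (eval A _ n)).Splitting),
      (∀ i < k, IsZero (S.X₁.X i)) ∧ (∀ i ≥ k, IsZero (S.X₃.X i)) ∧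
      (∀ i ≥ k, Nonempty (S.X₁.X i ≅ X.X i)) ∧ ∀ i < k, Nonempty (S.X₃.X i ≅ X.X i) := by
  have hB : ∀ i : ℤ, ∃ (Y : A) (β : Y ⟶ X.X i) (ρ : X.X i ⟶ Y), β ≫ ρ = 𝟙 Y ∧
      (k ≤ i → ρ ≫ β = 𝟙 _) ∧ (i < k → IsZero Y) := by
    intro i
    by_cases hi : k ≤ i
    · exact ⟨X.X i, 𝟙 _, 𝟙 _, by simp, by simp, by omega⟩
    · exact ⟨0, 0, 0, (isZero_zero A).eq_of_src _ _, by omega, fun _ => isZero_zero A⟩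
  have hS : ∀ i : ℤ, ∃ (Y : A) (σ : Y ⟶ X.X i) (π : X.X i ⟶ Y), σ ≫ π = 𝟙 Y ∧
      (i < k → π ≫ σ = 𝟙 _) ∧ (k ≤ i → IsZero Y) := by
    intro i
    by_cases hi : k ≤ i
    · exact ⟨0, 0, 0, (isZero_zero A).eq_of_src _ _, by omega, fun _ => isZero_zero A⟩
    · exact ⟨X.X i, 𝟙 _, 𝟙 _, by simp, by simp, by omega⟩
  choose B β ρ hβρ hρβ hB0 using hB
  choose Q σ π hσπ hπσ hQ0 using hS
  have hβ : ∀ i j, i + 1 = j → β i ≫ X.d i j ≫ ρ j ≫ β j = β i ≫ X.d i j := by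
    intro i j hij
    by_cases hi : k ≤ i
    · rw [hρβ j (by omega), Category.comp_id]
    · exact (hB0 i (by omega)).eq_of_src _ _
  have hπ : ∀ i j, i + 1 = j → π i ≫ σ i ≫ X.d i j ≫ π j = X.d i j ≫ π j := by
    intro i j hij
    by_cases hi : i < k
    · rw [reassoc_of% (hπσ i hi)]
    · exact (hQ0 j (by omega)).eq_of_tgt _ _
  let KB : CochainComplex A ℤ :=
    { X := B
      d := fun i j => β i ≫ X.d i j ≫ ρ j
      shape := fun i j hij => by simp [X.shape i j hij]
      d_comp_d' := fun i j l hij hjl => by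
        have := hβ i j hij
        simp only [Category.assoc]
        rw [reassoc_of% this]
        simp }
  let KQ : CochainComplex A ℤ :=
    { X := Q
      d := fun i j => σ i ≫ X.d i j ≫ π j
      shape := fun i j hij => by simp [X.shape i j hij]
      d_comp_d' := fun i j l hij hjl => by
        have := hπ j l hjl
        simp only [Category.assoc]
        rw [this]
        simp }
  let ι : KB ⟶ X :=
    { f := β
      comm' := fun i j hij => by simpa [KB] using (hβ i j hij).symm }
  let p : X ⟶ KQ :=
    { f := π
      comm' := fun i j hij => by simpa [KQ] using (hπ i j hij) }
  have w : ι ≫ p = 0 := by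
    ext i
    by_cases hi : k ≤ i
    · exact (hQ0 i hi).eq_of_tgt _ _
    · exact (hB0 i (by omega)).eq_of_src _ _
  refine ⟨ShortComplex.mk ι p w, rfl, fun n => ⟨ρ n, σ n, hβρ n, hσπ n, ?_⟩,
    hB0, hQ0, fun i hi => ⟨⟨β i, ρ i, hβρ i, hρβ i hi⟩⟩,
    fun i hi => ⟨⟨σ i, π i, hσπ i, hπσ i hi⟩⟩⟩
  change ρ n ≫ β n + π n ≫ σ n = 𝟙 _
  by_cases hn : k ≤ n
  · rw [hρβ n hn, (hQ0 n hn).eq_of_src (σ n) 0, comp_zero, add_zero]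
  · rw [hπσ n (by omega), (hB0 n (by omega)).eq_of_src (β n) 0, comp_zero, zero_add]

end CochainComplex

/-- The complexes with terms in `𝒞` which vanish in degrees `> k`. -/
def TermsLE (𝒞 : Set A) (k : ℤ) (W : HomotopyCategory A (ComplexShape.up ℤ)) : Prop :=
  TermsIn 𝒞 W ∧ ∀ i > k, IsZero (W.as.X i)

/-- The morphisms whose cone receives no nonzero morphism from a complex with terms in `𝒞`
vanishing in degrees `> k`. -/
def IsTruncMap (𝒞 : Set A) (k : ℤ) {T X : HomotopyCategory A (ComplexShape.up ℤ)}
    (f : T ⟶ X) : Prop :=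
  ∃ (Z : HomotopyCategory A (ComplexShape.up ℤ)) (g : X ⟶ Z) (h : Z ⟶ T⟦(1 : ℤ)⟧),
    Triangle.mk f g h ∈ distTriang _ ∧ ∀ W, TermsLE 𝒞 k W → ∀ u : W ⟶ Z, u = 0

namespace HomotopyCategory

lemma exists_shift_as_X_iso (X : HomotopyCategory A (ComplexShape.up ℤ)) (n i : ℤ) :
    Nonempty ((X⟦n⟧).as.X i ≅ X.as.X (i + n)) := by
  obtain ⟨K, rfl⟩ := quotient_obj_surjective X
  rw [shift_quotient_obj]
  exact ⟨Iso.refl _⟩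

lemma isZero_shift_as_X {X : HomotopyCategory A (ComplexShape.up ℤ)} {n i j : ℤ}
    (h : i + n = j) (hX : IsZero (X.as.X j)) : IsZero ((X⟦n⟧).as.X i) := by
  subst h
  obtain ⟨e⟩ := exists_shift_as_X_iso X n i
  exact hX.of_iso e

end HomotopyCategory

open HomotopyCategory

lemma TermsIn.shift {𝒞 : Set A} (h𝒞 : IsAddKaroubi 𝒞)
    {X : HomotopyCategory A (ComplexShape.up ℤ)} (hX : TermsIn 𝒞 X) (n : ℤ) :
    TermsIn 𝒞 (X⟦n⟧) := by
  intro i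
  obtain ⟨e⟩ := exists_shift_as_X_iso X n i
  exact h𝒞.iso e.symm (hX _)

lemma TermsLE.shift {𝒞 : Set A} (h𝒞 : IsAddKaroubi 𝒞) {k : ℤ}
    {X : HomotopyCategory A (ComplexShape.up ℤ)} (hX : TermsLE 𝒞 k X) (n : ℤ) {l : ℤ}
    (h : k ≤ l + n) : TermsLE 𝒞 l (X⟦n⟧) :=
  ⟨hX.1.shift h𝒞 n, fun i hi => isZero_shift_as_X rfl (hX.2 _ (by omega))⟩

lemma TermsIn.exists_brutal_triangle {𝒞 : Set A} (h𝒞 : IsAddKaroubi 𝒞)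
    {X : HomotopyCategory A (ComplexShape.up ℤ)} (hX : TermsIn 𝒞 X) (k : ℤ) :
    ∃ (D B : HomotopyCategory A (ComplexShape.up ℤ)) (m : D ⟶ B) (g : B ⟶ X)
      (h : X ⟶ D⟦(1 : ℤ)⟧), Triangle.mk m g h ∈ distTriang _ ∧ TermsLE 𝒞 k D ∧ TermsIn 𝒞 B ∧
      (∀ i < k, IsZero (B.as.X i)) ∧ (∀ i, IsZero (X.as.X i) → IsZero (B.as.X i)) ∧
      ∀ i, IsZero (X.as.X (i - 1)) → IsZero (D.as.X i) := by
  obtain ⟨K, rfl⟩ := quotient_obj_surjective X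
  obtain ⟨S, rfl, σ, h₁, h₂, h₃, h₄⟩ := CochainComplex.exists_brutal_truncation K k
  have hT := inv_rot_of_distTriang _ ((distinguished_iff_iso_trianglehOfDegreewiseSplit _).2
    ⟨S, σ, ⟨Iso.refl _⟩⟩)
  have hS : ∀ i, S.X₃.X i ∈ 𝒞 ∧ (IsZero (S.X₂.X i) → IsZero (S.X₃.X i)) := by
    intro i
    by_cases hi : i < k
    · obtain ⟨e⟩ := h₄ i hi
      exact ⟨h𝒞.iso e.symm (hX i), fun h => h.of_iso e⟩
    · exact ⟨h𝒞.zero _ (h₂ i (by omega)), fun _ => h₂ i (by omega)⟩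
  have hB : ∀ i, S.X₁.X i ∈ 𝒞 ∧ (IsZero (S.X₂.X i) → IsZero (S.X₁.X i)) := by
    intro i
    by_cases hi : k ≤ i
    · obtain ⟨e⟩ := h₃ i hi
      exact ⟨h𝒞.iso e.symm (hX i), fun h => h.of_iso e⟩
    · exact ⟨h𝒞.zero _ (h₁ i (by omega)), fun _ => h₁ i (by omega)⟩
  have hS' : TermsIn 𝒞 ((quotient A (ComplexShape.up ℤ)).obj S.X₃) := fun i => (hS i).1
  refine ⟨((quotient A (ComplexShape.up ℤ)).obj S.X₃)⟦(-1 : ℤ)⟧,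
    (quotient A (ComplexShape.up ℤ)).obj S.X₁, _, _, _, hT,
    ⟨hS'.shift h𝒞 _, fun i hi => isZero_shift_as_X rfl (h₂ _ (by omega))⟩, fun i => (hB i).1, h₁,
    fun i => (hB i).2, fun i hi => isZero_shift_as_X rfl ((hS _).2 hi)⟩

lemma TermsIn.exists_cone {𝒞 : Set A} (h𝒞 : IsAddKaroubi 𝒞)
    {P Q : HomotopyCategory A (ComplexShape.up ℤ)} (hP : TermsIn 𝒞 P) (hQ : TermsIn 𝒞 Q)
    (φ : P ⟶ Q) :
    ∃ (Z : HomotopyCategory A (ComplexShape.up ℤ)) (g : Q ⟶ Z) (h : Z ⟶ P⟦(1 : ℤ)⟧),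
      Triangle.mk φ g h ∈ distTriang _ ∧ TermsIn 𝒞 Z ∧
      ∀ i, IsZero (P.as.X (i + 1)) → IsZero (Q.as.X i) → IsZero (Z.as.X i) := by
  obtain ⟨K, rfl⟩ := quotient_obj_surjective P
  obtain ⟨L, rfl⟩ := quotient_obj_surjective Q
  obtain ⟨f, rfl⟩ := (quotient A (ComplexShape.up ℤ)).map_surjective φ
  refine ⟨_, _, _, mappingCone_triangleh_distinguished f, fun i => ?_, fun i h₁ h₂ =>
    (CochainComplex.mappingCone.isZero_X_iff f i).2 ⟨h₁, h₂⟩⟩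
  exact h𝒞.iso (homotopyCofiber.XIsoBiprod f i (i + 1) rfl).symm (h𝒞.biprod (hP (i + 1)) (hQ i))

lemma IsTruncMap.bijective {𝒞 : Set A} (h𝒞 : IsAddKaroubi 𝒞) {k : ℤ}
    {T X : HomotopyCategory A (ComplexShape.up ℤ)} {f : T ⟶ X} (hf : IsTruncMap 𝒞 k f)
    {W : HomotopyCategory A (ComplexShape.up ℤ)} (hW : TermsLE 𝒞 k W) :
    Function.Bijective (fun u : W ⟶ T => u ≫ f) := by
  obtain ⟨Z, g, h, hT, hZ⟩ := hf
  constructor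
  · intro u v huv
    rw [← sub_eq_zero]
    have h₁ : (u - v) ≫ f = 0 := by simpa [Preadditive.sub_comp, sub_eq_zero] using huv
    have h₂ : (u - v)⟦(1 : ℤ)⟧' ≫ f⟦(1 : ℤ)⟧' = 0 := by
      rw [← Functor.map_comp, h₁, Functor.map_zero]
    obtain ⟨w, hw⟩ : ∃ w : W⟦(1 : ℤ)⟧ ⟶ Z, (u - v)⟦(1 : ℤ)⟧' = w ≫ h :=
      Triangle.coyoneda_exact₁ _ hT ((u - v)⟦(1 : ℤ)⟧') h₂
    rw [hZ _ (hW.shift h𝒞 1 (by omega)) w, zero_comp] at hw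
    exact (shiftFunctor _ (1 : ℤ)).map_injective (by rw [hw, Functor.map_zero])
  · intro v
    obtain ⟨w, hw⟩ := Triangle.coyoneda_exact₂ _ hT v (hZ W hW _)
    exact ⟨w, hw.symm⟩

namespace CochainComplex

open ComplexShape

/-- A `𝒞`-resolution of the cycles in degree `k` of `K`, as a complex over `K`. -/
lemma exists_cyclesResolution {𝒞 : Set A} (K : CochainComplex A ℤ) (k : ℤ)
    (r : CResolution 𝒞 (kernel (K.d k (k + 1)))) :
    ∃ (P : CochainComplex A ℤ) (e : P ⟶ K), (∀ i > k, IsZero (P.X i)) ∧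
      (∀ (m : ℕ) (i : ℤ), i = k - m → Nonempty (P.X i ≅ r.obj m)) ∧
      (∀ V ∈ 𝒞, ∀ (i j l : ℤ), j ≤ k → i + 1 = j → j + 1 = l → ∀ x : V ⟶ P.X j,
        x ≫ P.d j l = 0 → x ≫ e.f j = 0 → ∃ h : V ⟶ P.X i, h ≫ P.d i j = x) ∧
      ∀ V ∈ 𝒞, ∀ y : V ⟶ K.X k, y ≫ K.d k (k + 1) = 0 → ∃ h : V ⟶ P.X k, h ≫ e.f k = y := by
  let R := ChainComplex.of r.obj r.d r.w
  have hR : ∀ m, R.d (m + 1) m = r.d m := fun m => ChainComplex.of_d _ _ _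
  let E := embeddingUpIntLE k
  have hE : ∀ m : ℕ, E.f m = k - m := fun m => rfl
  let I : ∀ (m : ℕ) {i : ℤ}, i = k - m → ((R.extend E).X i ≅ r.obj m) := fun m i hi =>
    R.extendXIso E (hi.symm ▸ hE m)
  have hd : ∀ (m : ℕ) {i j : ℤ} (hi : i = k - ((m + 1 : ℕ) : ℤ)) (hj : j = k - m),
      (R.extend E).d i j = (I (m + 1) hi).hom ≫ r.d m ≫ (I m hj).inv := by
    intro m i j hi hj
    rw [← hR]
    exact R.extend_d_eq E _ _
  have h₀ : k = k - ((0 : ℕ) : ℤ) := by simp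
  let π : R.extend E ⟶ (HomologicalComplex.single A (up ℤ) k).obj (kernel (K.d k (k + 1))) :=
    mkHomToSingle ((I 0 h₀).hom ≫ r.ε) (by
      intro i hi
      have hi' : i + 1 = k := hi
      rw [hd 0 (i := i) (j := k) (by simp; omega) h₀]
      simp [r.w0])
  let ι : (HomologicalComplex.single A (up ℤ) k).obj (kernel (K.d k (k + 1))) ⟶ K :=
    mkHomFromSingle (kernel.ι (K.d k (k + 1))) (by
      intro j hj
      obtain rfl : k + 1 = j := hj
      exact kernel.condition _)
  have he : (π ≫ ι).f k = (I 0 h₀).hom ≫ r.ε ≫ kernel.ι (K.d k (k + 1)) := by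
    rw [comp_f, mkHomToSingle_f, mkHomFromSingle_f]
    simp
  refine ⟨R.extend E, π ≫ ι, fun i hi => ?_, fun m i hi => ⟨I m hi⟩, ?_, ?_⟩
  · exact R.isZero_extend_X E i ((notMem_range_embeddingUpIntLE_iff k i).2 hi)
  · intro V hV i j l hj hij hjl x hx hx'
    obtain ⟨m, hm⟩ : ∃ m : ℕ, j = k - m := ⟨(k - j).toNat, by omega⟩
    have hm' : i = k - ((m + 1 : ℕ) : ℤ) := by omega
    suffices ∃ h : V ⟶ r.obj (m + 1), h ≫ r.d m = x ≫ (I m hm).hom by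
      obtain ⟨h, hh⟩ := this
      exact ⟨h ≫ (I (m + 1) hm').inv, by simp [hd m hm' hm, reassoc_of% hh]⟩
    obtain _ | m := m
    · obtain rfl : j = k := by simpa using hm
      refine r.homExact0 V hV _ ?_
      rw [he] at hx'
      rw [← cancel_mono (kernel.ι (K.d j (j + 1)))]
      simpa using hx'
    · refine r.homExact m V hV _ ?_
      have hl : l = k - m := by omega
      rw [hd m hm hl] at hx
      rw [← cancel_mono (I m hl).inv]
      simpa using hx
  · intro V hV y hy
    obtain ⟨h, hh⟩ := r.homSurj V hV (kernel.lift _ y hy)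
    exact ⟨h ≫ (I 0 h₀).inv, by simp [he, reassoc_of% hh]⟩

open HomComplex in
/-- The cone of a resolution of the cycles is acyclic in low degrees with respect to `𝒞`. -/
lemma mappingCone.exists_comp_d_eq {P K : CochainComplex A ℤ} (e : P ⟶ K) {V : A} {k : ℤ}
    (hK : ∀ i < k, IsZero (K.X i)) (hP : ∀ i > k, IsZero (P.X i))
    (h₁ : ∀ (i j l : ℤ), j ≤ k → i + 1 = j → j + 1 = l → ∀ x : V ⟶ P.X j,
      x ≫ P.d j l = 0 → x ≫ e.f j = 0 → ∃ h : V ⟶ P.X i, h ≫ P.d i j = x)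
    (h₂ : ∀ y : V ⟶ K.X k, y ≫ K.d k (k + 1) = 0 → ∃ h : V ⟶ P.X k, h ≫ e.f k = y)
    (i : ℤ) (hi : i ≤ k) (g : V ⟶ (mappingCone e).X i)
    (hg : g ≫ (mappingCone e).d i (i + 1) = 0) :
    ∃ h, h ≫ (mappingCone e).d (i - 1) i = g := by
  obtain ⟨x, y, rfl⟩ := decomp_to e g (i + 1) rfl
  rw [ext_to_iff e (i + 1) (i + 2) (by omega)] at hg
  simp only [Category.assoc, Preadditive.add_comp, zero_comp, d_fst_v e i (i + 1) (i + 2) rfl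
    (by omega), d_snd_v e i (i + 1) rfl] at hg
  simp at hg
  obtain ⟨hx, hy⟩ := hg
  suffices ∃ h : V ⟶ P.X i, h ≫ e.f i = y ∧ h ≫ P.d i (i + 1) = -x by
    obtain ⟨h, rfl, hh⟩ := this
    refine ⟨h ≫ (inl e).v i (i - 1) (by omega), ?_⟩
    rw [Category.assoc, inl_v_d e i (i - 1) (i + 1) (by omega) (by omega), Preadditive.comp_sub,
      reassoc_of% hh]
    simp [add_comm]
  obtain hi | rfl := hi.lt_or_eq
  · have hy₀ : y = 0 := (hK i hi).eq_of_tgt _ _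
    obtain ⟨h, hh⟩ := h₁ i (i + 1) (i + 2) (by omega) rfl (by omega) (-x) (by simpa using hx)
      (by simpa [hy₀] using hy)
    exact ⟨h, (hK i hi).eq_of_tgt _ _, hh⟩
  · have hx₀ : x = 0 := (hP (i + 1) (by omega)).eq_of_tgt _ _
    obtain ⟨h, hh⟩ := h₂ y (by simpa [hx₀] using hy)
    exact ⟨h, hh, (hP (i + 1) (by omega)).eq_of_tgt _ _⟩

end CochainComplex

/-- A complex bounded below by `k` receives a truncation map from a bounded complex. -/
lemma exists_isTruncMap_of_isZero {𝒞 : Set A} (h𝒞 : IsAddKaroubi 𝒞) {n : ℕ} (hn : CDimLE 𝒞 n)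
    (k : ℤ) (B : HomotopyCategory A (ComplexShape.up ℤ)) (hB : ∀ i < k, IsZero (B.as.X i)) :
    ∃ (T : HomotopyCategory A (ComplexShape.up ℤ)) (f : T ⟶ B),
      InTCb 𝒞 T ∧ TermsLE 𝒞 k T ∧ IsTruncMap 𝒞 k f := by
  obtain ⟨K, rfl⟩ := quotient_obj_surjective B
  obtain ⟨r, hr⟩ := hn (kernel (K.d k (k + 1)))
  obtain ⟨P, e, hP, hP', h₁, h₂⟩ := CochainComplex.exists_cyclesResolution K k r
  have hP₁ : TermsIn 𝒞 ((quotient A (ComplexShape.up ℤ)).obj P) := by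
    intro i
    by_cases hi : k < i
    · exact h𝒞.zero _ (hP i hi)
    · obtain ⟨I⟩ := hP' (k - i).toNat i (by omega)
      exact h𝒞.iso I.symm (r.mem _)
  refine ⟨_, (quotient A (ComplexShape.up ℤ)).map e, ⟨⟨k - n, k, fun i hi => ?_⟩, hP₁⟩, ⟨hP₁, hP⟩,
    _, _, _, mappingCone_triangleh_distinguished e, fun W hW u => ?_⟩
  · by_cases hi' : k < i
    · exact hP i hi'
    · obtain ⟨I⟩ := hP' (k - i).toNat i (by omega)
      exact (hr _ (by omega)).of_iso I
  · obtain ⟨L, rfl⟩ := quotient_obj_surjective W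
    obtain ⟨u, rfl⟩ := (quotient A (ComplexShape.up ℤ)).map_surjective u
    obtain ⟨H⟩ := CochainComplex.nonempty_homotopy_zero u k hW.2 fun i hi =>
      CochainComplex.mappingCone.exists_comp_d_eq e hB hP (h₁ _ (hW.1 i)) (h₂ _ (hW.1 i)) i hi
    exact (eq_of_homotopy _ _ H).trans (Functor.map_zero _ _ _)

/-- Every bounded complex with terms in `𝒞` has a bounded truncation in degrees `≤ k`. -/
lemma InTCb.exists_isTruncMap {𝒞 : Set A} (h𝒞 : IsAddKaroubi 𝒞) {n : ℕ} (hn : CDimLE 𝒞 n)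
    (k : ℤ) {X : HomotopyCategory A (ComplexShape.up ℤ)} (hX : InTCb 𝒞 X) :
    ∃ (T : HomotopyCategory A (ComplexShape.up ℤ)) (f : T ⟶ X),
      InTCb 𝒞 T ∧ TermsLE 𝒞 k T ∧ IsTruncMap 𝒞 k f := by
  obtain ⟨⟨a, b, hab⟩, hX'⟩ := hX
  obtain ⟨D, B, m, g, h, hT, hD, hB, hB₁, -, hD₁⟩ := hX'.exists_brutal_triangle h𝒞 k
  obtain ⟨M, e, ⟨⟨a', b', hM₁⟩, hM₂⟩, hM, he⟩ := exists_isTruncMap_of_isZero h𝒞 hn k B hB₁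
  obtain ⟨φ, rfl⟩ := (he.bijective h𝒞 hD).2 m
  obtain ⟨Z, v, w, hZ, he'⟩ := he
  obtain ⟨T, p, q, hT', hT₁, hT₂⟩ := hD.1.exists_cone h𝒞 hM₂ φ
  let O := Triangulated.someOctahedron rfl hT' hZ hT
  refine ⟨T, O.m₁, ⟨⟨min a a' - 1, max b b' + 1, fun i hi => ?_⟩, hT₁⟩, ⟨hT₁, fun i hi => ?_⟩,
    Z, O.m₃, _, O.mem, he'⟩
  · exact hT₂ i (hD₁ _ (hab _ (by omega))) (hM₁ _ (by omega))
  · exact hT₂ i (hD.2 _ (by omega)) (hM.2 _ (by omega))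

lemma TermsLE.hom_eq_zero {𝒞 : Set A} (h𝒞 : IsAddKaroubi 𝒞)
    {X : HomotopyCategory A (ComplexShape.up ℤ)}
    (hX : ∀ Y, InTleC 𝒞 Y → ∀ f : Y⟦(1 : ℤ)⟧ ⟶ X, f = 0)
    {W : HomotopyCategory A (ComplexShape.up ℤ)} (hW : TermsLE 𝒞 (-1) W) (u : W ⟶ X) : u = 0 := by
  have hY : TermsLE 𝒞 0 (W⟦(-1 : ℤ)⟧) := hW.shift h𝒞 _ (by omega)
  have := hX _ ⟨⟨⟨0, hY.2⟩, hY.2⟩, hY.1⟩ ((shiftNegShift W (1 : ℤ)).hom ≫ u)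
  rwa [← cancel_epi (shiftNegShift W (1 : ℤ)).hom, comp_zero]

lemma InTleCb.inTleC {𝒞 : Set A} {Y : HomotopyCategory A (ComplexShape.up ℤ)}
    (hY : InTleCb 𝒞 Y) : InTleC 𝒞 Y :=
  ⟨⟨⟨0, hY.2⟩, hY.2⟩, hY.1.2⟩

lemma InTCb.shift {𝒞 : Set A} (h𝒞 : IsAddKaroubi 𝒞)
    {X : HomotopyCategory A (ComplexShape.up ℤ)} (hX : InTCb 𝒞 X) (n : ℤ) :
    InTCb 𝒞 (X⟦n⟧) := by
  obtain ⟨⟨a, b, hab⟩, hX⟩ := hX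
  exact ⟨⟨a - n, b - n, fun i hi => isZero_shift_as_X rfl (hab _ (by omega))⟩, hX.shift h𝒞 n⟩

/-- An object of the bounded heart lies in the heart. -/
lemma InHCb.inHC {𝒞 : Set A} (h𝒞 : IsAddKaroubi 𝒞) {n : ℕ} (hn : CDimLE 𝒞 n)
    {X : HomotopyCategory A (ComplexShape.up ℤ)} (hX : InHCb 𝒞 X) : InHC 𝒞 X := by
  obtain ⟨T, t, hT, hT', ht⟩ := hX.1.1.exists_isTruncMap h𝒞 hn (-1)
  have ht₀ : t = 0 := by
    have hY : TermsLE 𝒞 0 (T⟦(-1 : ℤ)⟧) := hT'.shift h𝒞 _ (by omega)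
    have := hX.2 _ ⟨hT.shift h𝒞 _, hY.2⟩ ((shiftNegShift T (1 : ℤ)).hom ≫ t)
    rwa [← cancel_epi (shiftNegShift T (1 : ℤ)).hom, comp_zero]
  refine ⟨hX.1.inTleC, ⟨⟨0, hX.1.2⟩, hX.1.1.2⟩, fun Y hY f => ?_⟩
  have hY' : TermsLE 𝒞 0 Y := ⟨hY.2, hY.1.2⟩
  obtain ⟨u, rfl⟩ := (ht.bijective h𝒞 (hY'.shift h𝒞 1 (by omega))).2 f
  simp [ht₀]

/-- Every object of the heart is isomorphic to an object of the bounded heart. -/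
lemma InHC.exists_iso {𝒞 : Set A} (h𝒞 : IsAddKaroubi 𝒞) {n : ℕ} (hn : CDimLE 𝒞 n)
    {V : HomotopyCategory A (ComplexShape.up ℤ)} (hV : InHC 𝒞 V) :
    ∃ W, InHCb 𝒞 W ∧ Nonempty (W ≅ V) := by
  obtain ⟨D, B, m, g, h, hT, hD, hB, hB₁, hB₂, -⟩ := hV.1.2.exists_brutal_triangle h𝒞 (-1)
  have hm : IsTruncMap 𝒞 (-1) m := ⟨V, g, h, hT, fun W hW u => hW.hom_eq_zero h𝒞 hV.2.2 u⟩
  have hB₃ : ∀ i > 0, IsZero (B.as.X i) := fun i hi => hB₂ i (hV.1.1.2 i hi)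
  have hBb : InTCb 𝒞 B := ⟨⟨-1, 0, fun i hi => hi.elim (hB₁ i) (hB₃ i)⟩, hB⟩
  obtain ⟨T, t, ⟨⟨a, b, hab⟩, hT₁⟩, hT₂, ht⟩ := hBb.exists_isTruncMap h𝒞 hn (-1)
  obtain ⟨W, p, q, hW, hW₁, hW₂⟩ := hT₁.exists_cone h𝒞 hB t
  obtain ⟨α, hα⟩ := (hm.bijective h𝒞 hT₂).2 t
  obtain ⟨β, hβ⟩ := (ht.bijective h𝒞 hD).2 m
  dsimp only at hα hβ
  let e : T ≅ D := ⟨α, β, (ht.bijective h𝒞 hT₂).1 (by simp [hα, hβ]),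
    (hm.bijective h𝒞 hD).1 (by simp [hα, hβ])⟩
  let e' : W ≅ V := Triangle.π₃.mapIso (isoTriangleOfIso₁₂ _ _ hW hT e (Iso.refl _)
    ((Category.comp_id t).trans hα.symm))
  refine ⟨W, ⟨⟨⟨⟨min (-1) (a - 1), max 0 b, fun i hi => ?_⟩, hW₁⟩, fun i hi => ?_⟩,
    fun Y hY f => ?_⟩, ⟨e'⟩⟩
  · exact hW₂ i (hab _ (by omega)) (by by_cases h : i < -1; exacts [hB₁ i h, hB₃ i (by omega)])
  · exact hW₂ i (hT₂.2 _ (by omega)) (hB₃ i hi)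
  · rw [← cancel_mono e'.hom, zero_comp]
    exact hV.2.2 Y hY.inTleC _

end BoundedTruncation

/-!
STATEMENT 3: Assume `C` is `A`-approximating and `A` has finite `C`-dimension.  Then
`T^b_C ∩ T≤0_C` is a t-structure on `T^b_C = K^b(C)` (the inclusion admits a right adjoint,
expressed pointwise below), and its heart is equivalent, via the inclusion `T^b_C → T_C`,
to the heart `H_C` of the t-structure `T≤0_C` on `T_C`.  Since `T^b_C ⊆ T_C` is a full
subcategory, the equivalence of hearts amounts to: a bounded object lies in the bounded heart
iff it lies in `H_C`, and every object of `H_C` is isomorphic to an object of the bounded heart.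
-/
theorem statement3 {A : Type u} [Category.{v} A] [Abelian A]
    (𝒞 : Set A) (h𝒞 : IsAddKaroubi 𝒞) (happrox : CApproximating 𝒞)
    (hdim : ∃ n : ℕ, CDimLE 𝒞 n) :
    -- `T^b_C ∩ T≤0_C` is a t-structure on `T^b_C`:
    (∀ X, InTCb 𝒞 X →
      ∃ (tX : HomotopyCategory A (ComplexShape.up ℤ)) (f : tX ⟶ X),
        InTleCb 𝒞 tX ∧ ∀ W, InTleCb 𝒞 W → Function.Bijective (fun g : W ⟶ tX => g ≫ f))
    -- the hearts agree on bounded objects: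
    ∧ (∀ X, InTCb 𝒞 X → (InHCb 𝒞 X ↔ InHC 𝒞 X))
    -- and the inclusion of hearts is essentially surjective:
    ∧ (∀ V, InHC 𝒞 V →
        ∃ W, InHCb 𝒞 W ∧ Nonempty (W ≅ V)) := by
  obtain ⟨n, hn⟩ := hdim
  refine ⟨fun X hX => ?_, fun X hX => ⟨InHCb.inHC h𝒞 hn, fun h => ⟨⟨hX, h.1.1.2⟩,
    fun Y hY f => h.2.2 Y hY.inTleC f⟩⟩, fun V hV => hV.exists_iso h𝒞 hn⟩
  obtain ⟨T, f, hT, hT', hf⟩ := hX.exists_isTruncMap h𝒞 hn 0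
  exact ⟨T, f, ⟨hT, hT'.2⟩, fun W hW => hf.bijective h𝒞 ⟨hW.1.2, hW.2⟩⟩
end

section
/- Assume C is 𝒜-approximating. Then: (a) the truncation functor τ≥0_𝒜 maps H_C into H_𝒜, and τ≥0_𝒜 : H_C → H_𝒜 is left adjoint to π_C : H_𝒜 → H_C; (b) the unit Id_{H_C} → π_C ∘ τ≥0_𝒜 of this adjunction is an isomorphism; and (c) the functor π_C : H_𝒜 → H_C is exact. -/
open CategoryTheory Limits

universe v u

variable {A : Type u} [Category.{v} A] [Abelian A]

/-- Essential (isomorphism-closed) membership in the heart `H_A`. -/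
def EssInHA {A : Type u} [Category.{v} A] [Abelian A]
    (X : HomotopyCategory A (ComplexShape.up ℤ)) : Prop :=
  ∃ W, InHA W ∧ Nonempty (W ≅ X)

/-- Essential (isomorphism-closed) membership in the heart `H_C`. -/
def EssInHC {A : Type u} [Category.{v} A] [Abelian A] (𝒞 : Set A)
    (X : HomotopyCategory A (ComplexShape.up ℤ)) : Prop :=
  ∃ W, InHC 𝒞 W ∧ Nonempty (W ≅ X)

/-- `η : X ⟶ tX` realizes `tX` as the truncation `τ≥0_A X`: `tX ∈ T≥0_A` and `η` is
universal among maps to objects of `T≥0_A` (pointwise left adjoint of the inclusion). -/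
def IsTgeTrunc {A : Type u} [Category.{v} A] [Abelian A]
    {X tX : HomotopyCategory A (ComplexShape.up ℤ)} (η : X ⟶ tX) : Prop :=
  InTgeA tX ∧ ∀ W, InTgeA W → Function.Bijective (fun g : tX ⟶ W => η ≫ g)

namespace CochainComplex

open scoped ZeroObject

/-- A degreewise split subcomplex together with its quotient: the brutal truncations. -/
lemma exists_brutal_truncation_s5 (K : CochainComplex A ℤ) (n : ℤ) :
    ∃ (S U : CochainComplex A ℤ) (f : S ⟶ K) (q : K ⟶ U) (w : f ≫ q = 0)
      (_ : ∀ i, ((ShortComplex.mk f q w).map (HomologicalComplex.eval A _ i)).Splitting),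
      (∀ i < n, IsZero (S.X i)) ∧ (∀ i, n ≤ i → IsZero (U.X i)) ∧
      (∀ i, n ≤ i → Nonempty (S.X i ≅ K.X i)) ∧
      (∀ i < n, Nonempty (U.X i ≅ K.X i)) := by
  have key : ∀ i, ∃ (S U : A) (f : S ⟶ K.X i) (q : K.X i ⟶ U) (r : K.X i ⟶ S) (s : U ⟶ K.X i),
      f ≫ q = 0 ∧ f ≫ r = 𝟙 _ ∧ s ≫ q = 𝟙 _ ∧ r ≫ f + q ≫ s = 𝟙 _ ∧
      (i < n → IsZero S) ∧ (n ≤ i → IsZero U) ∧ (n ≤ i → Nonempty (S ≅ K.X i)) ∧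
      (i < n → Nonempty (U ≅ K.X i)) := by
    intro i
    by_cases h : n ≤ i
    · exact ⟨K.X i, 0, 𝟙 _, 0, 𝟙 _, 0, by simp, by simp, (isZero_zero A).eq_of_src _ _, by simp,
        fun h' => by lia, fun _ => isZero_zero A, fun _ => ⟨Iso.refl _⟩, fun h' => by lia⟩
    · exact ⟨0, K.X i, 0, 𝟙 _, 0, 𝟙 _, by simp, (isZero_zero A).eq_of_src _ _, by simp, by simp,
        fun _ => isZero_zero A, fun h' => by lia, fun h' => by lia, fun _ => ⟨Iso.refl _⟩⟩
  choose S U f q r s fq fr sq rq hS hU eS eU using key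
  have fdq : ∀ i j, f i ≫ K.d i j ≫ q j = 0 := by
    intro i j
    by_cases hij : i + 1 = j
    · by_cases h : n ≤ i
      · simp [(hU j (by lia)).eq_of_tgt (q j) 0]
      · simp [(hS i (by lia)).eq_of_src (f i) 0]
    · rw [K.shape _ _ hij]; simp
  have hf : ∀ i j, f i ≫ K.d i j ≫ r j ≫ f j = f i ≫ K.d i j := by
    intro i j
    have h0 := congr($(fdq i j) ≫ s j)
    have h1 := congr(f i ≫ K.d i j ≫ $(rq j))
    simp only [Category.assoc, zero_comp] at h0
    simpa [h0] using h1
  have hq : ∀ i j, q i ≫ s i ≫ K.d i j ≫ q j = K.d i j ≫ q j := by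
    intro i j
    have h1 := congr($(rq i) ≫ K.d i j ≫ q j)
    simpa [fdq] using h1
  let S' : CochainComplex A ℤ :=
    { X := S
      d i j := f i ≫ K.d i j ≫ r j
      shape i j h := by simp [K.shape i j h]
      d_comp_d' i j k _ _ := by simp [reassoc_of% (hf i j)] }
  let U' : CochainComplex A ℤ :=
    { X := U
      d i j := s i ≫ K.d i j ≫ q j
      shape i j h := by simp [K.shape i j h]
      d_comp_d' i j k _ _ := by simp [hq j k] }
  let f' : S' ⟶ K := { f := f, comm' i j _ := by simp [S', hf] }
  let q' : K ⟶ U' := { f := q, comm' i j _ := by simp [U', hq] }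
  exact ⟨S', U', f', q', by ext i; exact fq i,
    fun i => { r := r i, s := s i, f_r := fr i, s_g := sq i, id := rq i }, hS, hU, eS, eU⟩

/-- `j : B ⟶ K` is the inclusion of the canonical truncation `τ≤n K`: it is characterized by the
morphisms which factor through it in each degree. -/
structure IsCanonicalTruncation (n : ℤ) {B K : CochainComplex A ℤ} (j : B ⟶ K) : Prop where
  mono : ∀ i, Mono (j.f i)
  factors_iff : ∀ (i : ℤ) (T : A) (φ : T ⟶ K.X i), (∃ l : T ⟶ B.X i, l ≫ j.f i = φ) ↔
    ((n ≤ i → φ ≫ K.d i (i + 1) = 0) ∧ (n < i → φ = 0))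

lemma exists_isCanonicalTruncation (K : CochainComplex A ℤ) (n : ℤ) :
    ∃ (B : CochainComplex A ℤ) (j : B ⟶ K), IsCanonicalTruncation n j := by
  have key : ∀ i, ∃ (B : A) (f : B ⟶ K.X i), Mono f ∧
      ∀ (T : A) (φ : T ⟶ K.X i), (∃ l : T ⟶ B, l ≫ f = φ) ↔
        ((n ≤ i → φ ≫ K.d i (i + 1) = 0) ∧ (n < i → φ = 0)) := by
    intro i
    rcases lt_trichotomy i n with h | h | h
    · exact ⟨_, 𝟙 _, inferInstance, fun T φ => ⟨fun _ => ⟨by lia, by lia⟩, fun _ => ⟨φ, by simp⟩⟩⟩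
    · refine ⟨_, kernel.ι (K.d i (i + 1)), inferInstance, fun T φ => ⟨?_, fun h' => ?_⟩⟩
      · rintro ⟨l, rfl⟩
        exact ⟨by simp, by lia⟩
      · exact ⟨kernel.lift _ φ (h'.1 (by lia)), by simp⟩
    · refine ⟨0, 0, ⟨fun _ _ _ => (isZero_zero A).eq_of_tgt _ _⟩, fun T φ => ⟨?_, fun h' => ?_⟩⟩
      · rintro ⟨l, rfl⟩
        simp
      · exact ⟨0, by simp [h'.2 h]⟩
  choose B f hmono hf using key
  have hD : ∀ i j, ∃ D : B i ⟶ B j, D ≫ f j = f i ≫ K.d i j := by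
    intro i j
    by_cases hij : i + 1 = j
    · subst hij
      have := (hf i _ (f i)).1 ⟨𝟙 _, by simp⟩
      exact (hf _ _ _).2 ⟨by simp, fun h => this.1 (by lia)⟩
    · exact ⟨0, by simp [K.shape i j hij]⟩
  choose D hD using hD
  let B' : CochainComplex A ℤ :=
    { X := B
      d := D
      shape i j h := by
        rw [← cancel_mono (f j), hD, K.shape i j h]; simp
      d_comp_d' i j k _ _ := by
        rw [← cancel_mono (f k)]; simp [hD, reassoc_of% (hD i j)] }
  exact ⟨B', { f := f, comm' i j _ := (hD i j).symm }, hmono, hf⟩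

namespace IsCanonicalTruncation

variable {n : ℤ} {B K : CochainComplex A ℤ} {j : B ⟶ K}

lemma isZero (hj : IsCanonicalTruncation n j) {i : ℤ} (hi : n < i) : IsZero (B.X i) := by
  have := hj.mono i
  have h0 : j.f i = 0 := ((hj.factors_iff i _ (j.f i)).1 ⟨𝟙 _, by simp⟩).2 hi
  rw [IsZero.iff_id_eq_zero, ← cancel_mono (j.f i)]
  simp [h0]

lemma isIso (hj : IsCanonicalTruncation n j) {i : ℤ} (hi : i < n) : IsIso (j.f i) := by
  have := hj.mono i
  obtain ⟨l, hl⟩ := (hj.factors_iff i _ (𝟙 (K.X i))).2 ⟨by lia, by lia⟩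
  exact ⟨l, by simp [← cancel_mono (j.f i), hl], hl⟩

lemma exists_lift (hj : IsCanonicalTruncation n j) {T : CochainComplex A ℤ} (φ : T ⟶ K)
    (hφ : ∀ i, (n ≤ i → φ.f i ≫ K.d i (i + 1) = 0) ∧ (n < i → φ.f i = 0)) :
    ∃ ψ : T ⟶ B, ψ ≫ j = φ := by
  choose ψ hψ using fun i => (hj.factors_iff i _ (φ.f i)).2 (hφ i)
  refine ⟨{ f := ψ, comm' := fun i k _ => ?_ }, by ext i; exact hψ i⟩
  have := hj.mono k
  rw [← cancel_mono (j.f k), Category.assoc, Category.assoc, hψ, ← j.comm,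
    reassoc_of% (hψ i), φ.comm]

lemma exists_lift_of_isZero (hj : IsCanonicalTruncation n j) {T : CochainComplex A ℤ}
    (hT : ∀ i > n, IsZero (T.X i)) (φ : T ⟶ K) :
    ∃ ψ : T ⟶ B, ψ ≫ j = φ :=
  hj.exists_lift φ fun i => ⟨fun hi => by
    rw [φ.comm, (hT (i + 1) (by lia)).eq_of_src (φ.f (i + 1)) 0, comp_zero],
    fun hi => (hT i hi).eq_of_src _ _⟩

lemma nonempty_homotopy_zero (hj : IsCanonicalTruncation n j) {U : CochainComplex A ℤ}
    (hU : ∀ i > n + 1, IsZero (U.X i)) (f : U ⟶ B) (h : Homotopy (f ≫ j) 0) : Nonempty (Homotopy f 0) := by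
  have hd : ∀ i, h.hom (i + 1) i ≫ K.d i (i + 1) =
      f.f (i + 1) ≫ j.f (i + 1) - U.d (i + 1) (i + 1 + 1) ≫ h.hom (i + 1 + 1) (i + 1) := by
    intro i
    have := h.comm (i + 1)
    rw [dNext_eq h.hom (show (ComplexShape.up ℤ).Rel (i + 1) (i + 1 + 1) from rfl),
      prevD_eq h.hom (show (ComplexShape.up ℤ).Rel i (i + 1) from rfl)] at this
    simp only [HomologicalComplex.comp_f, HomologicalComplex.zero_f, add_zero] at this
    rw [this]
    abel
  have hl : ∀ i, ∃ l : U.X (i + 1) ⟶ B.X i, l ≫ j.f i = h.hom (i + 1) i := by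
    refine fun i => (hj.factors_iff i _ _).2 ⟨fun hi => ?_, fun hi => (hU _ (by lia)).eq_of_src _ _⟩
    rw [hd, (hU (i + 1 + 1) (by lia)).eq_of_src (h.hom (i + 1 + 1) (i + 1)) 0,
      (hj.isZero (show n < i + 1 by lia)).eq_of_tgt (f.f (i + 1)) 0]
    simp
  have hl' : ∀ i k, (ComplexShape.up ℤ).Rel k i → ∃ l : U.X i ⟶ B.X k, l ≫ j.f k = h.hom i k := by
    rintro _ k rfl
    exact hl k
  choose l hl using hl'
  have hf : f = Homotopy.nullHomotopicMap' l := by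
    ext i
    obtain ⟨i, rfl⟩ : ∃ k, i = k + 1 := ⟨i - 1, by lia⟩
    have := hj.mono (i + 1)
    rw [← cancel_mono (j.f (i + 1)), Homotopy.nullHomotopicMap'_f
      (show (ComplexShape.up ℤ).Rel i (i + 1) from rfl)
      (show (ComplexShape.up ℤ).Rel (i + 1) (i + 1 + 1) from rfl)]
    simp only [Preadditive.add_comp, Category.assoc, ← j.comm, hl, reassoc_of% hl, hd]
    abel
  rw [hf]
  exact ⟨Homotopy.nullHomotopy' l⟩

end IsCanonicalTruncation

end CochainComplex

namespace HomotopyCategory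

open Pretriangulated

/-- A morphism from a complex in degrees `≥ n` to a complex in degrees `< n` vanishes. -/
lemma hom_eq_zero_of_isZero {S B : HomotopyCategory A (ComplexShape.up ℤ)} (n : ℤ)
    (hS : ∀ i < n, IsZero (S.as.X i)) (hB : ∀ i, n ≤ i → IsZero (B.as.X i)) (f : S ⟶ B) :
    f = 0 := by
  obtain ⟨φ, rfl⟩ := (HomotopyCategory.quotient A (ComplexShape.up ℤ)).map_surjective
    (X := S.as) (Y := B.as) f
  have : φ = 0 := by
    ext i
    by_cases h : i < n
    · exact (hS i h).eq_of_src _ _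
    · exact (hB i (by lia)).eq_of_tgt _ _
  rw [this, Functor.map_zero]
  rfl

/-- The distinguished triangle `σ≥n X ⟶ X ⟶ σ<n X` of brutal truncations. -/
lemma exists_brutal_triangle (X : HomotopyCategory A (ComplexShape.up ℤ)) (n : ℤ) :
    ∃ (S U : HomotopyCategory A (ComplexShape.up ℤ)) (i : S ⟶ X) (p : X ⟶ U)
      (δ : U ⟶ S⟦(1 : ℤ)⟧), Triangle.mk i p δ ∈ distTriang _ ∧
      (∀ i < n, IsZero (S.as.X i)) ∧ (∀ i, n ≤ i → IsZero (U.as.X i)) ∧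
      (∀ i, n ≤ i → Nonempty (S.as.X i ≅ X.as.X i)) ∧
      (∀ i < n, Nonempty (U.as.X i ≅ X.as.X i)) := by
  obtain ⟨S, U, f, q, w, σ, h⟩ := CochainComplex.exists_brutal_truncation_s5 X.as n
  exact ⟨_, _, _, _, _,
    (distinguished_iff_iso_trianglehOfDegreewiseSplit _).2 ⟨_, σ, ⟨Iso.refl _⟩⟩, h⟩

/-- Up to isomorphism, the terms of a shift are the shifted terms. -/
lemma exists_iso_shift (X : HomotopyCategory A (ComplexShape.up ℤ)) (n : ℤ) :
    ∃ Y : HomotopyCategory A (ComplexShape.up ℤ), Nonempty (Y ≅ X⟦n⟧) ∧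
      ∀ i, Y.as.X i = X.as.X (i + n) :=
  ⟨(quotient A _).obj (X.as⟦n⟧), ⟨((quotient A _).commShiftIso n).app _⟩, fun _ => rfl⟩

/-- `τ≤n X ⟶ X`: morphisms from complexes in degrees `≤ n` factor through it, and it induces an
injection on morphisms from complexes in degrees `≤ n + 1`. -/
lemma exists_canonical_truncation_triangle (X : HomotopyCategory A (ComplexShape.up ℤ)) (n m : ℤ)
    (hnm : n ≤ m) (hX : ∀ i > m, IsZero (X.as.X i)) :
    ∃ (B W : HomotopyCategory A (ComplexShape.up ℤ)) (j : B ⟶ X) (η : X ⟶ W)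
      (δ : W ⟶ B⟦(1 : ℤ)⟧), Triangle.mk j η δ ∈ distTriang _ ∧
      (∀ i > n, IsZero (B.as.X i)) ∧ (∀ i > m, IsZero (W.as.X i)) ∧
      (∀ U : HomotopyCategory A (ComplexShape.up ℤ), (∀ i > n, IsZero (U.as.X i)) →
        ∀ f : U ⟶ X, ∃ g : U ⟶ B, g ≫ j = f) ∧
      (∀ U : HomotopyCategory A (ComplexShape.up ℤ), (∀ i > n + 1, IsZero (U.as.X i)) →
        ∀ f : U ⟶ B, f ≫ j = 0 → f = 0) := by
  obtain ⟨B, j, hj⟩ := CochainComplex.exists_isCanonicalTruncation X.as n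
  refine ⟨_, _, _, _, _, mappingCone_triangleh_distinguished j, fun i hi => hj.isZero hi,
    fun i hi => (CochainComplex.mappingCone.isZero_X_iff j i).2
      ⟨hj.isZero (by lia), hX i hi⟩, fun U hU f => ?_, fun U hU f hf => ?_⟩
  · obtain ⟨φ, rfl⟩ := (quotient A (ComplexShape.up ℤ)).map_surjective (X := U.as) (Y := X.as) f
    obtain ⟨ψ, rfl⟩ := hj.exists_lift_of_isZero hU φ
    exact ⟨(quotient A _).map ψ, ((quotient A _).map_comp ψ j).symm⟩
  · obtain ⟨φ, rfl⟩ := (quotient A (ComplexShape.up ℤ)).map_surjective (X := U.as) (Y := B) f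
    have h0 : (quotient A (ComplexShape.up ℤ)).map (φ ≫ j) = 0 := by
      rw [Functor.map_comp]
      exact hf
    obtain ⟨h⟩ := (quotient_map_eq_zero_iff _).1 h0
    exact (quotient_map_eq_zero_iff _).2 (hj.nonempty_homotopy_zero hU φ h)

lemma exists_iso_of_brutal_truncation_hom_eq_zero (𝒞 : Set A) (h𝒞 : IsAddKaroubi 𝒞)
    (X : HomotopyCategory A (ComplexShape.up ℤ)) (hX : TermsIn 𝒞 X)
    (hzero : ∀ S : HomotopyCategory A (ComplexShape.up ℤ), (∀ i < 1, IsZero (S.as.X i)) →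
      (∀ i ≥ 1, Nonempty (S.as.X i ≅ X.as.X i)) → ∀ f : S ⟶ X, f = 0) :
    ∃ W : HomotopyCategory A (ComplexShape.up ℤ), Nonempty (W ≅ X) ∧ TermsIn 𝒞 W ∧
      ∀ i > 0, IsZero (W.as.X i) := by
  obtain ⟨K⟩ := X
  change ∀ i, K.X i ∈ 𝒞 at hX
  obtain ⟨S, U, f, q, w, σ, hS, hU, eS, -⟩ := CochainComplex.exists_brutal_truncation_s5 K 1
  obtain ⟨h⟩ := (quotient_map_eq_zero_iff f).1
    (hzero ((quotient A (ComplexShape.up ℤ)).obj S) hS eS ((quotient A _).map f))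
  obtain ⟨B, j, hj⟩ := CochainComplex.exists_isCanonicalTruncation K 0
  let r : ∀ i, K.X i ⟶ S.X i := fun i => (σ i).r
  let t : ∀ i, U.X i ⟶ K.X i := fun i => (σ i).s
  have hfr : ∀ i, f.f i ≫ r i = 𝟙 _ := fun i => (σ i).f_r
  have hrf : ∀ i, 1 ≤ i → r i ≫ f.f i = 𝟙 _ := fun i hi => by
    have : r i ≫ f.f i + q.f i ≫ t i = 𝟙 _ := (σ i).id
    rwa [(hU i hi).eq_of_tgt (q.f i) 0, zero_comp, add_zero] at this
  have hr : ∀ i < 1, r i = 0 := fun i hi => (hS i hi).eq_of_tgt _ _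
  let N : K ⟶ K := Homotopy.nullHomotopicMap' fun i k _ => r i ≫ h.hom i k
  have hN : ∀ i, N.f (i + 1) = K.d (i + 1) (i + 1 + 1) ≫ r (i + 1 + 1) ≫ h.hom (i + 1 + 1) (i + 1)
      + (r (i + 1) ≫ h.hom (i + 1) i) ≫ K.d i (i + 1) := fun i =>
    Homotopy.nullHomotopicMap'_f (show (ComplexShape.up ℤ).Rel i (i + 1) from rfl)
      (show (ComplexShape.up ℤ).Rel (i + 1) (i + 1 + 1) from rfl) _
  have hN1 : ∀ i, 1 ≤ i → N.f i = 𝟙 _ := by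
    intro i hi
    obtain ⟨i, rfl⟩ : ∃ k, i = k + 1 := ⟨i - 1, by lia⟩
    have hc := h.comm (i + 1)
    rw [dNext_eq h.hom (show (ComplexShape.up ℤ).Rel (i + 1) (i + 1 + 1) from rfl),
      prevD_eq h.hom (show (ComplexShape.up ℤ).Rel i (i + 1) from rfl)] at hc
    simp only [HomologicalComplex.zero_f, add_zero] at hc
    have hdr : K.d (i + 1) (i + 1 + 1) ≫ r (i + 1 + 1) =
        r (i + 1) ≫ S.d (i + 1) (i + 1 + 1) := by
      rw [← Category.id_comp (K.d _ _), ← hrf _ hi, Category.assoc, Category.assoc,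
        f.comm_assoc, hfr, Category.comp_id]
    rw [hN, reassoc_of% hdr, ← hrf _ hi, hc]
    simp
  have hφ1 : ∀ i, 1 ≤ i → (𝟙 K - N).f i = 0 := fun i hi => by simp [hN1 i hi]
  obtain ⟨ψ, hψ⟩ := hj.exists_lift (𝟙 K - N) fun i => ⟨fun hi => by
    rw [(𝟙 K - N).comm, hφ1 _ (by lia), comp_zero], fun hi => hφ1 i (by lia)⟩
  have hQ : (quotient A (ComplexShape.up ℤ)).map (ψ ≫ j) = 𝟙 _ := by
    rw [hψ, Functor.map_sub, (quotient_map_eq_zero_iff N).2 ⟨Homotopy.nullHomotopy' _⟩]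
    simp
  have hB : ∀ i > 0, IsZero (B.X i) := fun i hi => hj.isZero hi
  have hQ' : (quotient A (ComplexShape.up ℤ)).map (j ≫ ψ) = 𝟙 _ := by
    have h0 : (quotient A (ComplexShape.up ℤ)).map ((j ≫ ψ - 𝟙 B) ≫ j) = 0 := by
      rw [Preadditive.sub_comp, Functor.map_sub, Category.assoc, Functor.map_comp, hQ]
      simp
    obtain ⟨h'⟩ := (quotient_map_eq_zero_iff _).1 h0
    have := (quotient_map_eq_zero_iff _).2
      (hj.nonempty_homotopy_zero (fun i hi => hB i (by lia)) _ h')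
    rwa [Functor.map_sub, sub_eq_zero, CategoryTheory.Functor.map_id] at this
  refine ⟨(quotient A _).obj B, ⟨⟨(quotient A _).map j, (quotient A _).map ψ,
    ((quotient A _).map_comp j ψ).symm.trans hQ',
    ((quotient A _).map_comp ψ j).symm.trans hQ⟩⟩, fun i => ?_, hB⟩
  change B.X i ∈ 𝒞
  rcases lt_trichotomy i 0 with hi | rfl | hi
  · have := hj.isIso hi
    exact h𝒞.iso (asIso (j.f i)).symm (hX i)
  · refine h𝒞.summand (hX 0) (j.f 0) (ψ.f 0) ?_
    have := hj.mono 0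
    have hjN : ∀ i, i = 0 → j.f i ≫ N.f i = 0 := by
      intro i hi
      obtain ⟨i, rfl⟩ : ∃ k, i = k + 1 := ⟨i - 1, by lia⟩
      have hjd : j.f (i + 1) ≫ K.d (i + 1) (i + 1 + 1) = 0 :=
        ((hj.factors_iff (i + 1) _ (j.f (i + 1))).1 ⟨𝟙 _, by simp⟩).1 hi.ge
      rw [hN, hr (i + 1) (by lia), zero_comp, zero_comp, add_zero, reassoc_of% hjd, zero_comp]
    have hN0 := hjN 0 rfl
    rw [← cancel_mono (j.f 0), Category.assoc, ← HomologicalComplex.comp_f, hψ]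
    simp [hN0]
  · exact h𝒞.zero _ (hB i hi)

lemma exists_shift_one_iso (U : HomotopyCategory A (ComplexShape.up ℤ)) :
    ∃ Y : HomotopyCategory A (ComplexShape.up ℤ), Nonempty (Y⟦(1 : ℤ)⟧ ≅ U) ∧
      ∀ i, Y.as.X i = U.as.X (i + -1) := by
  obtain ⟨Y, ⟨e⟩, hY⟩ := exists_iso_shift U (-1)
  exact ⟨Y, ⟨(shiftFunctor _ (1 : ℤ)).mapIso e ≪≫
    (shiftFunctorCompIsoId _ (-1 : ℤ) 1 (by simp)).app U⟩, hY⟩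

lemma inTgeA_iff (X : HomotopyCategory A (ComplexShape.up ℤ)) :
    InTgeA X ↔ BddAbv X ∧ ∀ U : HomotopyCategory A (ComplexShape.up ℤ),
      (∀ i, 0 ≤ i → IsZero (U.as.X i)) → ∀ f : U ⟶ X, f = 0 := by
  refine and_congr_right fun _ => ⟨fun h U hU f => ?_, fun h Y hY f => ?_⟩
  · obtain ⟨Y, ⟨e⟩, hY⟩ := exists_shift_one_iso U
    have h0 : ∀ i > 0, IsZero (Y.as.X i) := fun i hi => by
      rw [hY]
      exact hU _ (by lia)
    rw [← cancel_epi e.hom, comp_zero]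
    exact h Y ⟨⟨0, h0⟩, h0⟩ _
  · obtain ⟨U, ⟨e⟩, hU⟩ := exists_iso_shift Y 1
    rw [← cancel_epi e.hom, comp_zero]
    refine h U (fun i hi => ?_) _
    rw [hU]
    exact hY.2 _ (by lia)

lemma inTgeC_iff (𝒞 : Set A) (X : HomotopyCategory A (ComplexShape.up ℤ)) :
    InTgeC 𝒞 X ↔ InTC 𝒞 X ∧ ∀ U : HomotopyCategory A (ComplexShape.up ℤ),
      (∀ i, 0 ≤ i → IsZero (U.as.X i)) → TermsIn 𝒞 U → ∀ f : U ⟶ X, f = 0 := by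
  refine and_congr_right fun _ => ⟨fun h U hU hU' f => ?_, fun h Y hY f => ?_⟩
  · obtain ⟨Y, ⟨e⟩, hY⟩ := exists_shift_one_iso U
    have h0 : ∀ i > 0, IsZero (Y.as.X i) := fun i hi => by
      rw [hY]
      exact hU _ (by lia)
    have h1 : TermsIn 𝒞 Y := fun i => by
      rw [hY]
      exact hU' _
    rw [← cancel_epi e.hom, comp_zero]
    exact h Y ⟨⟨⟨0, h0⟩, h0⟩, h1⟩ _
  · obtain ⟨U, ⟨e⟩, hU⟩ := exists_iso_shift Y 1
    rw [← cancel_epi e.hom, comp_zero]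
    refine h U (fun i hi => ?_) (fun i => ?_) _
    · rw [hU]
      exact hY.1.2 _ (by lia)
    · rw [hU]
      exact hY.2 _

/-- The truncation triangle `τ≤-1 V ⟶ V ⟶ τ≥0 V` of an object of `T≤0_A`. -/
lemma exists_isTgeTrunc_triangle {V : HomotopyCategory A (ComplexShape.up ℤ)} (hV : InTleA V) :
    ∃ (B W : HomotopyCategory A (ComplexShape.up ℤ)) (j : B ⟶ V) (η : V ⟶ W)
      (δ : W ⟶ B⟦(1 : ℤ)⟧), Triangle.mk j η δ ∈ distTriang _ ∧
      (∀ i, 0 ≤ i → IsZero (B.as.X i)) ∧ InHA W ∧ IsTgeTrunc η ∧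
      (∀ U : HomotopyCategory A (ComplexShape.up ℤ), (∀ i > 0, IsZero (U.as.X i)) →
        ∀ f : U ⟶ B, f ≫ j = 0 → f = 0) := by
  obtain ⟨B, W, j, η, δ, hT, hB, hW, hlift, hinj⟩ :=
    exists_canonical_truncation_triangle V (-1) 0 (by lia) hV.2
  have hB' : ∀ i, 0 ≤ i → IsZero (B.as.X i) := fun i hi => hB i (by lia)
  have hWb : BddAbv W := ⟨0, hW⟩
  have hWge : InTgeA W := by
    refine ⟨hWb, fun Y hY f => ?_⟩
    obtain ⟨y, hy⟩ := (shiftFunctor _ (1 : ℤ)).map_surjective (f ≫ δ)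
    have hyj : y ≫ j = 0 := by
      apply (shiftFunctor _ (1 : ℤ)).map_injective
      rw [Functor.map_comp, hy, Category.assoc, Functor.map_zero]
      exact (congr(f ≫ $(comp_distTriang_mor_zero₃₁ _ hT))).trans comp_zero
    rw [hinj Y (fun i hi => hY.2 i (by lia)) y hyj, Functor.map_zero] at hy
    obtain ⟨g, rfl⟩ : ∃ g, f = g ≫ η := Triangle.coyoneda_exact₃ _ hT f hy.symm
    obtain ⟨U, ⟨e⟩, hU⟩ := exists_iso_shift Y 1
    obtain ⟨k, hk⟩ := hlift U (fun i hi => by rw [hU]; exact hY.2 _ (by lia)) (e.hom ≫ g)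
    have : j ≫ η = 0 := comp_distTriang_mor_zero₁₂ _ hT
    rw [← cancel_epi e.hom, ← Category.assoc, ← hk, Category.assoc, this, comp_zero, comp_zero]
  refine ⟨B, W, j, η, δ, hT, hB', ⟨⟨hWb, hW⟩, hWge⟩, ⟨hWge, fun W' hW' => ⟨fun a b hab => ?_,
    fun f => ?_⟩⟩, fun U hU => hinj U fun i hi => hU i (by lia)⟩
  · obtain ⟨c, hc⟩ : ∃ c, a - b = δ ≫ c := Triangle.yoneda_exact₃ _ hT (a - b)
      (by change η ≫ (a - b) = 0; simpa [sub_eq_zero] using hab)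
    rw [hW'.2 B ⟨⟨0, fun i hi => hB' i hi.le⟩, fun i hi => hB' i hi.le⟩ c, comp_zero] at hc
    exact sub_eq_zero.1 hc
  · obtain ⟨g, hg⟩ := Triangle.yoneda_exact₂ _ hT f (((inTgeA_iff _).1 hW').2 B hB' _)
    exact ⟨g, hg.symm⟩

lemma exists_iso_of_isTgeTrunc {X Y Z : HomotopyCategory A (ComplexShape.up ℤ)} {η : X ⟶ Y}
    {θ : X ⟶ Z} (hη : IsTgeTrunc η) (hθ : IsTgeTrunc θ) : ∃ e : Y ≅ Z, η ≫ e.hom = θ := by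
  obtain ⟨a, ha⟩ := (hη.2 Z hθ.1).2 θ
  obtain ⟨b, hb⟩ := (hθ.2 Y hη.1).2 η
  dsimp only at ha hb
  exact ⟨⟨a, b, (hη.2 Y hη.1).1 (by dsimp only; rw [reassoc_of% ha, hb, Category.comp_id]),
    (hθ.2 Z hθ.1).1 (by dsimp only; rw [reassoc_of% hb, ha, Category.comp_id])⟩, ha⟩

/-- The truncation of an object of the heart `H_C` induces bijections on morphisms from `T_C`. -/
lemma bijective_comp_of_isTgeTrunc (𝒞 : Set A) (h𝒞 : IsAddKaroubi 𝒞)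
    {V tV : HomotopyCategory A (ComplexShape.up ℤ)} (hV : InHC 𝒞 V) {η : V ⟶ tV}
    (hη : IsTgeTrunc η) {X : HomotopyCategory A (ComplexShape.up ℤ)} (hX : InTC 𝒞 X) :
    Function.Bijective (fun g : X ⟶ V => g ≫ η) := by
  obtain ⟨B, W, j, θ, δ, hT, hB, -, hθ, hinj⟩ := exists_isTgeTrunc_triangle hV.1.1
  have key : ∀ X : HomotopyCategory A (ComplexShape.up ℤ), TermsIn 𝒞 X →
      ∀ f : X ⟶ B, f = 0 := by
    intro X hX f
    obtain ⟨S, U, i, p, ε, hT', hS, hU, -, eU⟩ := exists_brutal_triangle X 0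
    obtain ⟨g, rfl⟩ : ∃ g, f = p ≫ g := Triangle.yoneda_exact₂ _ hT' f
      (hom_eq_zero_of_isZero 0 hS hB _)
    rw [hinj U (fun i hi => hU i hi.le) g (((inTgeC_iff 𝒞 V).1 hV.2).2 U hU (fun i => ?_) _),
      comp_zero]
    by_cases hi : i < 0
    · exact h𝒞.iso (eU i hi).some.symm (hX i)
    · exact h𝒞.zero _ (hU i (by lia))
  have key' : ∀ f : X ⟶ B⟦(1 : ℤ)⟧, f = 0 := by
    intro f
    obtain ⟨Y, ⟨e⟩, hY⟩ := exists_shift_one_iso X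
    obtain ⟨y, hy⟩ := (shiftFunctor _ (1 : ℤ)).map_surjective (e.hom ≫ f)
    rw [← cancel_epi e.hom, ← hy, key Y (fun i => by rw [hY]; exact hX.2 _) y, Functor.map_zero,
      comp_zero]
  obtain ⟨e, rfl⟩ := exists_iso_of_isTgeTrunc hθ hη
  refine ⟨fun a b hab => ?_, fun f => ?_⟩
  · have h0 : (a - b) ≫ θ = 0 := by
      rw [← cancel_mono e.hom]
      simpa [sub_eq_zero] using hab
    obtain ⟨c, hc⟩ : ∃ c, a - b = c ≫ j := Triangle.coyoneda_exact₂ _ hT (a - b) h0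
    rw [key X hX.2 c, zero_comp] at hc
    exact sub_eq_zero.1 hc
  · obtain ⟨g, hg⟩ : ∃ g, f ≫ e.inv = g ≫ θ := Triangle.coyoneda_exact₃ _ hT (f ≫ e.inv) (key' _)
    exact ⟨g, by simp [← reassoc_of% hg]⟩

lemma isIso_of_isCApprox_isTgeTrunc (𝒞 : Set A) (h𝒞 : IsAddKaroubi 𝒞)
    {V tV tVc : HomotopyCategory A (ComplexShape.up ℤ)} (hV : InHC 𝒞 V) {η : V ⟶ tV}
    (hη : IsTgeTrunc η) {a : tVc ⟶ tV} (ha : IsCApprox 𝒞 a) (u : V ⟶ tVc) (hu : u ≫ a = η) :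
    IsIso u := by
  obtain ⟨v, hv⟩ := (bijective_comp_of_isTgeTrunc 𝒞 h𝒞 hV hη ha.1).2 a
  dsimp only at hv
  refine ⟨v, (bijective_comp_of_isTgeTrunc 𝒞 h𝒞 hV hη hV.2.1).1 ?_, (ha.2.2 _ ha.1).1 ?_⟩
  · simp only [Category.assoc, hv, hu, Category.id_comp]
  · simp only [Category.assoc, hv, hu, Category.id_comp]

/-- The `C`-approximation of an object of `H_A` lies in `H_C`. -/
lemma essInHC_of_isCApprox (𝒞 : Set A) (h𝒞 : IsAddKaroubi 𝒞)
    {X Xc : HomotopyCategory A (ComplexShape.up ℤ)} (hX : InHA X) {ε : Xc ⟶ X}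
    (hε : IsCApprox 𝒞 ε) : EssInHC 𝒞 Xc := by
  obtain ⟨N, hN⟩ := hε.1.1
  obtain ⟨W, ⟨e⟩, hWC, hW⟩ := exists_iso_of_brutal_truncation_hom_eq_zero 𝒞 h𝒞 Xc hε.1.2
    fun S hS eS f => by
      refine (hε.2.2 S ⟨⟨max N 0, fun i hi => ?_⟩, fun i => ?_⟩).1 ?_
      · exact (hN i (by lia)).of_iso (eS i (by lia)).some
      · by_cases hi : i < 1
        · exact h𝒞.zero _ (hS i hi)
        · exact h𝒞.iso (eS i (by lia)).some.symm (hε.1.2 i)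
      · exact (hom_eq_zero_of_isZero 1 hS (fun i hi => hX.1.2 i (by lia)) _).trans zero_comp.symm
  refine ⟨W, ⟨⟨⟨⟨0, hW⟩, hW⟩, hWC⟩, (inTgeC_iff 𝒞 W).2 ⟨⟨⟨0, hW⟩, hWC⟩, fun U hU hUC f => ?_⟩⟩, ⟨e⟩⟩
  rw [← cancel_mono e.hom]
  refine (hε.2.2 U ⟨⟨0, fun i hi => hU i hi.le⟩, hUC⟩).1 ?_
  simpa using ((inTgeA_iff X).1 hX.2).2 U hU ((f ≫ e.hom) ≫ ε)

lemma essInHA_of_inHA {X : HomotopyCategory A (ComplexShape.up ℤ)} (hX : InHA X) : EssInHA X :=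
  ⟨X, hX, ⟨Iso.refl X⟩⟩

section ShortExact

variable {𝒞 : Set A} {X Y Z Xc Yc Zc : HomotopyCategory A (ComplexShape.up ℤ)}
  {f : X ⟶ Y} {g : Y ⟶ Z} {εX : Xc ⟶ X} {εY : Yc ⟶ Y} {εZ : Zc ⟶ Z} {f' : Xc ⟶ Yc} {g' : Yc ⟶ Zc}

lemma monoIn_of_isCApprox (hX : InHA X) (hY : InHA Y) (hεX : IsCApprox 𝒞 εX)
    (hf' : f' ≫ εY = εX ≫ f) (hf : MonoIn EssInHA f) : MonoIn (EssInHC 𝒞) f' := by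
  rintro W ⟨W₀, hW₀, ⟨e⟩⟩ u v huv
  obtain ⟨_, T, _, η, _, _, _, hT, hη, _⟩ := exists_isTgeTrunc_triangle hW₀.1.1
  obtain ⟨a, ha⟩ := (hη.2 X hX.2).2 (e.hom ≫ u ≫ εX)
  obtain ⟨b, hb⟩ := (hη.2 X hX.2).2 (e.hom ≫ v ≫ εX)
  dsimp only at ha hb
  have hab : a = b := hf T (essInHA_of_inHA hT) a b <| (hη.2 Y hY.2).1 <| by
    dsimp only
    rw [reassoc_of% ha, reassoc_of% hb, ← hf', reassoc_of% huv]
  rw [← cancel_epi e.hom]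
  refine (hεX.2.2 W₀ hW₀.2.1).1 ?_
  simp only [Category.assoc]
  rw [← ha, ← hb, hab]

lemma isKernelIn_of_isCApprox (h𝒞 : IsAddKaroubi 𝒞) (hX : InHA X) (hY : InHA Y) (hZ : InHA Z)
    (hεX : IsCApprox 𝒞 εX) (hεY : IsCApprox 𝒞 εY) (hεZ : IsCApprox 𝒞 εZ)
    (hf' : f' ≫ εY = εX ≫ f) (hg' : g' ≫ εZ = εY ≫ g) (hf : MonoIn EssInHA f)
    (hfg : IsKernelIn EssInHA f g) : IsKernelIn (EssInHC 𝒞) f' g' := by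
  refine ⟨essInHC_of_isCApprox 𝒞 h𝒞 hX hεX, (hεZ.2.2 _ hεX.1).1 ?_, ?_⟩
  · simp only [Category.assoc, zero_comp]
    rw [hg', reassoc_of% hf', hfg.2.1, comp_zero]
  · intro W hW h hh
    obtain ⟨W₀, hW₀, ⟨e⟩⟩ := id hW
    obtain ⟨_, T, _, η, _, _, _, hT, hη, _⟩ := exists_isTgeTrunc_triangle hW₀.1.1
    obtain ⟨k, hk⟩ := (hη.2 Y hY.2).2 (e.hom ≫ h ≫ εY)
    dsimp only at hk
    have hkg : k ≫ g = 0 := (hη.2 Z hZ.2).1 <| by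
      dsimp only
      rw [reassoc_of% hk, ← hg', reassoc_of% hh]
      simp
    obtain ⟨l, hl, -⟩ := hfg.2.2 T (essInHA_of_inHA hT) k hkg
    obtain ⟨m, hm⟩ := (hεX.2.2 W₀ hW₀.2.1).2 (η ≫ l)
    dsimp only at hm
    have hmf : m ≫ f' = e.hom ≫ h := (hεY.2.2 W₀ hW₀.2.1).1 <| by
      simp only [Category.assoc]
      rw [hf', reassoc_of% hm, hl, hk]
    have hml : (e.inv ≫ m) ≫ f' = h := by simp [hmf]
    exact ⟨e.inv ≫ m, hml, fun m' hm' =>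
      monoIn_of_isCApprox hX hY hεX hf' hf W hW _ _ (hm'.trans hml.symm)⟩

/-- Morphisms from complexes in degrees `≥ 0` lift along epimorphisms of `H_A`. -/
lemma exists_lift_of_epiIn (hY : InHA Y) (hZ : InHA Z) (hg : EpiIn EssInHA g)
    {S : HomotopyCategory A (ComplexShape.up ℤ)} (hS : ∀ i < 0, IsZero (S.as.X i)) (s : S ⟶ Z) :
    ∃ t : S ⟶ Y, t ≫ g = s := by
  obtain ⟨C, p, δ, hC, hC0⟩ : ∃ (C : HomotopyCategory A (ComplexShape.up ℤ)) (p : Z ⟶ C)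
      (δ : C ⟶ Y⟦(1 : ℤ)⟧), Triangle.mk g p δ ∈ distTriang _ ∧ ∀ i > 0, IsZero (C.as.X i) := by
    obtain ⟨φ, rfl⟩ := (quotient A (ComplexShape.up ℤ)).map_surjective (X := Y.as) (Y := Z.as) g
    exact ⟨_, _, _, mappingCone_triangleh_distinguished φ, fun i hi =>
      (CochainComplex.mappingCone.isZero_X_iff φ i).2 ⟨hY.1.2 _ (by lia), hZ.1.2 i hi⟩⟩
  obtain ⟨B, T, j, η, _, hT, hB, hTA, -, -⟩ := exists_isTgeTrunc_triangle ⟨⟨0, hC0⟩, hC0⟩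
  have hgp : g ≫ p = 0 := comp_distTriang_mor_zero₁₂ _ hC
  have hpη : p ≫ η = 0 := hg T (essInHA_of_inHA hTA) _ _ (by
    rw [reassoc_of% hgp, zero_comp, comp_zero])
  obtain ⟨b, hb⟩ : ∃ b, s ≫ p = b ≫ j := Triangle.coyoneda_exact₂ _ hT (s ≫ p)
    (by change (s ≫ p) ≫ η = 0; rw [Category.assoc, hpη, comp_zero])
  rw [hom_eq_zero_of_isZero 0 hS hB b, zero_comp] at hb
  obtain ⟨t, ht⟩ := Triangle.coyoneda_exact₂ _ hC s hb
  exact ⟨t, ht.symm⟩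

lemma epiIn_of_isCApprox (h𝒞 : IsAddKaroubi 𝒞) (hY : InHA Y) (hZ : InHA Z)
    (hεY : IsCApprox 𝒞 εY) (hεZ : IsCApprox 𝒞 εZ) (hg' : g' ≫ εZ = εY ≫ g)
    (hg : EpiIn EssInHA g) : EpiIn (EssInHC 𝒞) g' := by
  rintro Q ⟨Q₀, hQ₀, ⟨e⟩⟩ u v huv
  obtain ⟨S, U, i, p, δ, hT, hS, hU, eS, eU⟩ := exists_brutal_triangle Zc 0
  obtain ⟨N, hN⟩ := hεZ.1.1
  have hSC : InTC 𝒞 S := ⟨⟨max N 0, fun k hk => (hN k (by lia)).of_iso (eS k (by lia)).some⟩,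
    fun k => by
      by_cases hk : k < 0
      · exact h𝒞.zero _ (hS k hk)
      · exact h𝒞.iso (eS k (by lia)).some.symm (hεZ.1.2 k)⟩
  have hUC : TermsIn 𝒞 U := fun k => by
    by_cases hk : k < 0
    · exact h𝒞.iso (eU k hk).some.symm (hεZ.1.2 k)
    · exact h𝒞.zero _ (hU k (by lia))
  obtain ⟨t, ht⟩ := exists_lift_of_epiIn hY hZ hg hS (i ≫ εZ)
  obtain ⟨r, hr⟩ := (hεY.2.2 S hSC).2 t
  dsimp only at hr
  have hri : r ≫ g' = i := (hεZ.2.2 S hSC).1 <| by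
    simp only [Category.assoc]
    rw [hg', reassoc_of% hr, ht]
  obtain ⟨q, hq⟩ : ∃ q, u - v = p ≫ q := Triangle.yoneda_exact₂ _ hT (u - v) <| by
    change i ≫ (u - v) = 0
    rw [← hri, Preadditive.comp_sub, Category.assoc, Category.assoc, huv, sub_self]
  have hq0 : q = 0 := by
    rw [← cancel_mono e.inv, zero_comp]
    exact ((inTgeC_iff 𝒞 Q₀).1 hQ₀.2).2 U hU hUC _
  rw [hq0, comp_zero] at hq
  exact sub_eq_zero.1 hq

end ShortExact

end HomotopyCategory

/-!
STATEMENT 5: Assume `C` is `A`-approximating.  Then: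
(a) `τ≥0_A` maps `H_C` into `H_A`;
(b) `τ≥0_A : H_C → H_A` is left adjoint to `π_C : H_A → H_C` and the unit
    `Id_{H_C} → π_C ∘ τ≥0_A` is an isomorphism;
(c) `π_C : H_A → H_C` is exact.
All functors are expressed pointwise: `π_C W` is any `C`-approximation `Wc ⟶ W`, and
`τ≥0_A V` is any truncation `η : V ⟶ tV` in the sense of `IsTgeTrunc`.  The adjunction is
the bijectivity of the correspondence `u ≫ ε = η ≫ g` between `u ∈ Hom_{H_C}(V, π_C W)`
and `g ∈ Hom_{H_A}(τ≥0_A V, W)`.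
-/
theorem statement5 {A : Type u} [Category.{v} A] [Abelian A]
    (𝒞 : Set A) (h𝒞 : IsAddKaroubi 𝒞) (happrox : CApproximating 𝒞) :
    -- (a) `τ≥0_A (H_C) ⊆ H_A`:
    (∀ V, InHC 𝒞 V → ∀ (tV : HomotopyCategory A (ComplexShape.up ℤ)) (η : V ⟶ tV),
      IsTgeTrunc η → EssInHA tV)
    -- (b) adjunction `τ≥0_A ⊣ π_C` on hearts:
    ∧ (∀ V, InHC 𝒞 V → ∀ (tV : HomotopyCategory A (ComplexShape.up ℤ)) (η : V ⟶ tV),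
        IsTgeTrunc η →
        ∀ W, InHA W → ∀ (Wc : HomotopyCategory A (ComplexShape.up ℤ)) (ε : Wc ⟶ W),
          IsCApprox 𝒞 ε →
          (∀ u : V ⟶ Wc, ∃! g : tV ⟶ W, u ≫ ε = η ≫ g) ∧
          (∀ g : tV ⟶ W, ∃! u : V ⟶ Wc, u ≫ ε = η ≫ g))
    -- (b) the unit `Id_{H_C} → π_C ∘ τ≥0_A` is an isomorphism:
    ∧ (∀ V, InHC 𝒞 V → ∀ (tV : HomotopyCategory A (ComplexShape.up ℤ)) (η : V ⟶ tV),
        IsTgeTrunc η →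
        ∀ (tVc : HomotopyCategory A (ComplexShape.up ℤ)) (a : tVc ⟶ tV), IsCApprox 𝒞 a →
          ∀ u : V ⟶ tVc, u ≫ a = η → IsIso u)
    -- (c) `π_C : H_A → H_C` is exact (it preserves short exact sequences):
    ∧ (∀ X Y Z, InHA X → InHA Y → InHA Z → ∀ (f : X ⟶ Y) (g : Y ⟶ Z),
        ShortExactIn EssInHA f g →
        ∀ (Xc Yc Zc : HomotopyCategory A (ComplexShape.up ℤ))
          (εX : Xc ⟶ X) (εY : Yc ⟶ Y) (εZ : Zc ⟶ Z),
          IsCApprox 𝒞 εX → IsCApprox 𝒞 εY → IsCApprox 𝒞 εZ →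
          ∀ (f' : Xc ⟶ Yc) (g' : Yc ⟶ Zc),
            f' ≫ εY = εX ≫ f → g' ≫ εZ = εY ≫ g →
            ShortExactIn (EssInHC 𝒞) f' g') := by
  refine ⟨fun V hV tV η hη => ?_, fun V hV tV η hη W hW Wc ε hε => ⟨fun u => ?_, fun g => ?_⟩,
    fun V hV tV η hη tVc a ha u hu =>
      HomotopyCategory.isIso_of_isCApprox_isTgeTrunc 𝒞 h𝒞 hV hη ha u hu,
    fun X Y Z hX hY hZ f g hfg Xc Yc Zc εX εY εZ hεX hεY hεZ f' g' hf' hg' =>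
      ⟨HomotopyCategory.monoIn_of_isCApprox hX hY hεX hf' hfg.1,
        HomotopyCategory.epiIn_of_isCApprox h𝒞 hY hZ hεY hεZ hg' hfg.2.1,
        HomotopyCategory.isKernelIn_of_isCApprox h𝒞 hX hY hZ hεX hεY hεZ hf' hg' hfg.1 hfg.2.2⟩⟩
  · obtain ⟨_, W, _, θ, _, _, _, hW, hθ, _⟩ := HomotopyCategory.exists_isTgeTrunc_triangle hV.1.1
    obtain ⟨e, -⟩ := HomotopyCategory.exists_iso_of_isTgeTrunc hθ hη
    exact ⟨W, hW, ⟨e⟩⟩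
  · simpa only [eq_comm] using (hη.2 W hW.2).existsUnique (u ≫ ε)
  · exact (hε.2.2 V hV.2.1).existsUnique (η ≫ g)
end
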